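/- Let K : L²(∂B_δ(0)) → Ξ be the compact double-layer restriction operator with injective adjoint (as above), and let u₀ be continuous on ℝᵈ \ B_R(0) and harmonic there with the appropriate behavior at infinity, and u₁ harmonic in a neighborhood of closure(B_a(x₀)). Then for every ε > 0 there exist infinitely many g ∈ C(∂B_δ(0)) such that the double-layer potential u = Dg satisfies ‖u + u₀ − u₁‖_{C(closure(B_a(x₀)))} ≤ ε and ‖u‖_{C(ℝᵈ \ B_R(0))} ≤ ε. -/

import Mathlib

open MeasureTheory Metric Filter
open scoped ENNReal RealInnerProductSpace

noncomputable section

/-- Euclidean space ℝ^d. -/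
abbrev Euc (d : ℕ) := EuclideanSpace ℝ (Fin d)

/-- Surface measure on the sphere of center `c` and radius `r`:
the (d-1)-dimensional Hausdorff measure restricted to the sphere. -/
def sphereMeasure {d : ℕ} (c : Euc d) (r : ℝ) : Measure (Euc d) :=
  (μH[((d : ℝ) - 1)]).restrict (sphere c r)

/-- Laplacian: sum of second derivatives along the coordinate directions. -/
def lap {d : ℕ} (f : Euc d → ℝ) (x : Euc d) : ℝ :=
  ∑ i : Fin d, iteratedDeriv 2 (fun t : ℝ => f (x + t • (EuclideanSpace.single i (1 : ℝ)))) 0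

/-- `f` is harmonic on `s`. -/
def IsHarmonicOn {d : ℕ} (f : Euc d → ℝ) (s : Set (Euc d)) : Prop :=
  ContDiffOn ℝ 2 f s ∧ ∀ x ∈ s, lap f x = 0

/-- Volume of the unit ball in ℝ^d. -/
def unitBallVol (d : ℕ) : ℝ := (volume (ball (0 : Euc d) 1)).toReal

/-- Fundamental solution of the Laplacian (d = 2 or 3). -/
def Phi (d : ℕ) (x y : Euc d) : ℝ :=
  if d = 2 then (1 / (2 * Real.pi)) * Real.log (1 / ‖x - y‖)
  else (1 / (4 * Real.pi)) * (1 / ‖x - y‖)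

/-- Normal derivative `∂Φ(x,y)/∂ν_y` of the fundamental solution in the second
variable, along the outward normal `(y - c)/r` of the sphere of center `c`, radius `r`. -/
def normalDerivY (d : ℕ) (c : Euc d) (r : ℝ) (x y : Euc d) : ℝ :=
  deriv (fun t : ℝ => Phi d x (y + t • (r⁻¹ • (y - c)))) 0

/-- Normal derivative `∂Φ(x,y)/∂ν_x` of the fundamental solution in the first
variable, along the outward normal `(x - c)/r` of the sphere of center `c`, radius `r`. -/
def normalDerivX (d : ℕ) (c : Euc d) (r : ℝ) (x y : Euc d) : ℝ :=
  deriv (fun t : ℝ => Phi d (x + t • (r⁻¹ • (x - c))) y) 0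

/-- Double layer potential with density `φ` on the sphere `∂B_δ(0)`. -/
def Dpot {d : ℕ} (δ : ℝ) (φ : Euc d → ℝ) (x : Euc d) : ℝ :=
  ∫ y, φ y * normalDerivY d 0 δ x y ∂(sphereMeasure (0 : Euc d) δ)



/-- basis vector -/
abbrev ee {d : ℕ} (i : Fin d) : Euc d := EuclideanSpace.single i (1 : ℝ)

/-- Laplacian through second Frechet derivatives -/
def L2 {d : ℕ} {F : Type*} [NormedAddCommGroup F] [NormedSpace ℝ F] (f : Euc d → F) (x : Euc d) : F :=
  ∑ i : Fin d, fderiv ℝ (fderiv ℝ f) x (ee i) (ee i)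

lemma hasDerivAt_line {d : ℕ} {F : Type*} [NormedAddCommGroup F] [NormedSpace ℝ F] {f : Euc d → F}
    {x e : Euc d} {t : ℝ} (hf : DifferentiableAt ℝ f (x + t • e)) :
    HasDerivAt (fun s : ℝ => f (x + s • e)) (fderiv ℝ f (x + t • e) e) t := by
  have h1 : HasDerivAt (fun s : ℝ => x + s • e) e t := by
    simpa using ((hasDerivAt_id t).smul_const e).const_add x
  exact hf.hasFDerivAt.comp_hasDerivAt t h1

lemma line_tendsto {d : ℕ} (x e : Euc d) : Tendsto (fun s : ℝ => x + s • e) (nhds 0) (nhds x) := by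
  have : Continuous (fun s : ℝ => x + s • e) := by fun_prop
  simpa using this.tendsto 0

lemma second_line {d : ℕ} {f : Euc d → ℝ} {x e : Euc d} (hf : ContDiffAt ℝ 2 f x) :
    deriv (fun s : ℝ => f (x + s • e)) 0 = fderiv ℝ f x e ∧
    HasDerivAt (deriv (fun s : ℝ => f (x + s • e))) (fderiv ℝ (fderiv ℝ f) x e e) 0 := by
  have h2 : ∀ᶠ y in nhds x, ContDiffAt ℝ 2 f y := hf.eventually (by simp)
  have h3 : ∀ᶠ s : ℝ in nhds 0, deriv (fun s : ℝ => f (x + s • e)) s = fderiv ℝ f (x + s • e) e := by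
    filter_upwards [(line_tendsto x e).eventually h2] with s hs
    exact (hasDerivAt_line (hs.differentiableAt (by simp))).deriv
  refine ⟨by simpa using h3.self_of_nhds, ?_⟩
  refine HasDerivAt.congr_of_eventuallyEq ?_ h3
  have hd : DifferentiableAt ℝ (fderiv ℝ f) x :=
    (hf.fderiv_right (m := 1) (by norm_num)).differentiableAt (by simp)
  have := hasDerivAt_line (f := fderiv ℝ f) (x := x) (e := e) (t := 0) (by simpa using hd)
  have h4 := this.clm_apply (hasDerivAt_const (0:ℝ) e)
  simpa using h4

lemma lap_eq_L2 {d : ℕ} {f : Euc d → ℝ} {x : Euc d} (hf : ContDiffAt ℝ 2 f x) :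
    lap f x = L2 f x := by
  unfold lap L2
  refine Finset.sum_congr rfl fun i _ => ?_
  rw [iteratedDeriv_succ, iteratedDeriv_one]
  exact (second_line hf).2.deriv

lemma L2_congr {d : ℕ} {F : Type*} [NormedAddCommGroup F] [NormedSpace ℝ F] {f g : Euc d → F} {x : Euc d}
    (h : f =ᶠ[nhds x] g) : L2 f x = L2 g x := by
  unfold L2
  have : fderiv ℝ f =ᶠ[nhds x] fderiv ℝ g := h.fderiv
  rw [this.fderiv_eq]

lemma second_le_of_max {f : ℝ → ℝ} (hc : ContinuousAt f 0) (h : IsLocalMax f 0) : deriv (deriv f) 0 ≤ 0 := by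
  by_contra! hp
  have h1 := h.deriv_eq_zero
  have h2 := isLocalMin_of_deriv_deriv_pos hp h1 hc
  have h3 : f =ᶠ[nhds 0] fun _ => f 0 := by
    filter_upwards [h, h2] with x a b using le_antisymm a b
  have h4 := h3.deriv
  have h5 := h4.deriv_eq
  simp at h5
  linarith

lemma L2_comp {d : ℕ} {F G : Type*} [NormedAddCommGroup F] [NormedSpace ℝ F] 
    [NormedAddCommGroup G] [NormedSpace ℝ G] (l : F →L[ℝ] G) {f : Euc d → F} {x : Euc d}
    (hf : ContDiffAt ℝ 2 f x) : L2 (fun y => l (f y)) x = l (L2 f x) := by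
  unfold L2
  have h2 : ∀ᶠ y in nhds x, ContDiffAt ℝ 2 f y := hf.eventually (by simp)
  have h3 : fderiv ℝ (fun y => l (f y)) =ᶠ[nhds x] fun y => l.comp (fderiv ℝ f y) := by
    filter_upwards [h2] with y hy
    exact (l.hasFDerivAt.comp y (hy.differentiableAt (by simp)).hasFDerivAt).fderiv
  have hd : DifferentiableAt ℝ (fderiv ℝ f) x :=
    (hf.fderiv_right (m := 1) (by norm_num)).differentiableAt (by simp)
  rw [h3.fderiv_eq, map_sum]
  refine Finset.sum_congr rfl fun i _ => ?_
  have := ((ContinuousLinearMap.compL ℝ (Euc d) F G l).hasFDerivAt.comp x hd.hasFDerivAt).fderiv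
  have e : (fun y => l.comp (fderiv ℝ f y)) = (⇑(ContinuousLinearMap.compL ℝ (Euc d) F G l) ∘ fderiv ℝ f) := rfl
  rw [e, this]
  rfl

lemma weak_max {d : ℕ} (hd : 0 < d) {δ : ℝ} (hδ : 0 < δ) {v : Euc d → ℝ} {U : Set (Euc d)} (hU : IsOpen U)
    (hsub : closedBall 0 δ ⊆ U) (hv : ContDiffOn ℝ 2 v U) (hl : ∀ x ∈ U, L2 v x = 0)
    (h0 : ∀ x ∈ sphere (0 : Euc d) δ, v x = 0) : ∀ x ∈ closedBall (0 : Euc d) δ, v x ≤ 0 := by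
  intro x hx
  have key : ∀ ε > 0, v x ≤ ε * δ ^ 2 := by
    intro ε hε
    set w : Euc d → ℝ := fun y => v y + ε * ‖y‖ ^ 2 with hw
    have hwc : ContDiffOn ℝ 2 w U := hv.add (contDiff_const.mul (contDiff_norm_sq ℝ)).contDiffOn
    obtain ⟨z, hz, hzm⟩ := (isCompact_closedBall (0 : Euc d) δ).exists_isMaxOn ⟨x, hx⟩
      (hwc.continuousOn.mono hsub)
    have hle : w x ≤ w z := hzm hx
    have hws : w z ≤ ε * δ ^ 2 := by
      by_cases hzs : z ∈ sphere (0 : Euc d) δ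
      · have : ‖z‖ = δ := by simpa using hzs
        simp [hw, h0 z hzs, this]
      · exfalso
        have hzb : z ∈ ball (0 : Euc d) δ := by
          simp at hz hzs ⊢
          exact lt_of_le_of_ne hz hzs
        have hzU : U ∈ nhds z := hU.mem_nhds (hsub hz)
        have hvz : ContDiffAt ℝ 2 v z := hv.contDiffAt hzU
        have hloc : IsLocalMax w z := by
          filter_upwards [isOpen_ball.mem_nhds hzb] with y hy using hzm (ball_subset_closedBall hy)
        have each : ∀ i : Fin d, fderiv ℝ (fderiv ℝ v) z (ee i) (ee i) + 2 * ε ≤ 0 := by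
          intro i
          have hline : IsLocalMax (fun s : ℝ => w (z + s • ee i)) 0 := by
            have := (line_tendsto z (ee i)).eventually hloc
            filter_upwards [this] with s hs
            simpa using hs
          have hcw : ContinuousAt (fun s : ℝ => w (z + s • ee i)) 0 := by
            have := (hwc.contDiffAt hzU).continuousAt
            refine ContinuousAt.comp (f := fun s : ℝ => z + s • ee i) (g := w) (by simpa using this) (by fun_prop)
          have h1 := second_le_of_max hcw hline
          rw [(second_line (hwc.contDiffAt hzU)).2.deriv] at h1
          have h2 : fderiv ℝ (fderiv ℝ w) z (ee i) (ee i) = fderiv ℝ (fderiv ℝ v) z (ee i) (ee i) + 2 * ε := by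
            rw [← (second_line (hwc.contDiffAt hzU)).2.deriv]
            have hev : ∀ᶠ s : ℝ in nhds 0, deriv (fun s : ℝ => w (z + s • ee i)) s
                = deriv (fun s : ℝ => v (z + s • ee i)) s + ε * (2 * z i + 2 * s) := by
              filter_upwards [(line_tendsto z (ee i)).eventually (hvz.eventually (by simp))] with s hs
              have a1 := hasDerivAt_line (f := v) (x := z) (e := ee i) (t := s) (hs.differentiableAt (by simp))
              have a2 : HasDerivAt (fun s : ℝ => ε * ‖z + s • ee i‖ ^ 2) (ε * (2 * z i + 2 * s)) s := by
                have : (fun s : ℝ => ε * ‖z + s • ee i‖ ^ 2) = fun s : ℝ => ε * (‖z‖ ^ 2 + 2 * (s * z i) + s ^ 2) := by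
                  funext s
                  rw [norm_add_sq_real, inner_smul_right, norm_smul]
                  simp [EuclideanSpace.inner_single_right]
                rw [this]
                have b : HasDerivAt (fun s : ℝ => ‖z‖ ^ 2 + 2 * (s * z i) + s ^ 2) (2 * (1 * z i) + 2 * s) s := by
                  have := ((((hasDerivAt_id s).mul_const (z i)).const_mul 2).const_add (‖z‖^2)).add ((hasDerivAt_id s).pow 2)
                  convert! this using 1
                  simp
                simpa using b.const_mul ε
              rw [a1.deriv]
              exact (a1.add a2).deriv
            rw [Filter.EventuallyEq.deriv_eq hev]
            have hh : HasDerivAt (fun s : ℝ => ε * (2 * z i + 2 * s)) (ε * (2 * 1)) 0 :=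
              (((hasDerivAt_id (0:ℝ)).const_mul 2).const_add _).const_mul ε
            refine ((second_line hvz).2.add hh).deriv.trans ?_
            ring
          linarith
        have hs := Finset.sum_le_sum (s := Finset.univ) fun (i : Fin d) _ => each i
        rw [Finset.sum_add_distrib] at hs
        have := hl z (hsub hz)
        unfold L2 at this
        rw [this] at hs
        simp at hs
        have : (0:ℝ) < d * (2 * ε) := by positivity
        linarith
    have : v x ≤ w x := by simp only [hw]; nlinarith [sq_nonneg ‖x‖]
    linarith
  have ht : Tendsto (fun ε : ℝ => ε * δ ^ 2) (nhdsWithin 0 (Set.Ioi 0)) (nhds 0) := by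
    have : Continuous (fun ε : ℝ => ε * δ ^ 2) := by fun_prop
    simpa using (this.tendsto 0).mono_left nhdsWithin_le_nhds
  exact ge_of_tendsto ht (by filter_upwards [self_mem_nhdsWithin] with ε hε using key ε hε)

lemma max_zero_L2 {d : ℕ} (hd : 0 < d) {δ : ℝ} (hδ : 0 < δ) {v : Euc d → ℝ} {U : Set (Euc d)} (hU : IsOpen U)
    (hsub : closedBall 0 δ ⊆ U) (hv : ContDiffOn ℝ 2 v U) (hl : ∀ x ∈ U, L2 v x = 0)
    (h0 : ∀ x ∈ sphere (0 : Euc d) δ, v x = 0) : ∀ x ∈ closedBall (0 : Euc d) δ, v x = 0 := by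
  intro x hx
  refine le_antisymm (weak_max hd hδ hU hsub hv hl h0 x hx) ?_
  have h := weak_max hd hδ hU hsub (v := fun y => (-ContinuousLinearMap.id ℝ ℝ) (v y)) (by simpa using hv.neg)
    (fun y hy => by rw [L2_comp _ (hv.contDiffAt (hU.mem_nhds hy)), hl y hy]; simp)
    (fun y hy => by simp [h0 y hy]) x hx
  simpa using h

lemma euler_second {V : Type*} [NormedAddCommGroup V] [NormedSpace ℝ V] {h : V → ℝ} {U : Set V} (hU : IsOpen U)
    (hh : ContDiffOn ℝ 4 h U) (x : V) (hx : x ∈ U) (e : V) :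
    DifferentiableAt ℝ (fun y => fderiv ℝ (fderiv ℝ h) y e e) x ∧
    fderiv ℝ (fderiv ℝ (fun y => fderiv ℝ h y y)) x e e =
      fderiv ℝ (fun y => fderiv ℝ (fderiv ℝ h) y e e) x x + 2 * fderiv ℝ (fderiv ℝ h) x e e := by
  have c1 : ContDiffOn ℝ 3 (fderiv ℝ h) U := hh.fderiv_of_isOpen hU (by norm_num)
  have c2 : ContDiffOn ℝ 2 (fderiv ℝ (fderiv ℝ h)) U := c1.fderiv_of_isOpen hU (by norm_num)
  have hUx := hU.mem_nhds hx
  set D1 := fderiv ℝ h with hD1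
  set D2 := fderiv ℝ D1 with hD2
  set D3 := fderiv ℝ D2 with hD3
  have d1 : ∀ y ∈ U, HasFDerivAt D1 (D2 y) y := fun y hy =>
    ((c1.contDiffAt (hU.mem_nhds hy)).differentiableAt (by simp)).hasFDerivAt
  have d2 : ∀ y ∈ U, HasFDerivAt D2 (D3 y) y := fun y hy =>
    ((c2.contDiffAt (hU.mem_nhds hy)).differentiableAt (by simp)).hasFDerivAt
  have sym1 : ∀ y ∈ U, ∀ a b, D2 y a b = D2 y b a := fun y hy a b =>
    second_derivative_symmetric_of_eventually (f := h) (f' := D1) (x := y)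
      (by filter_upwards [hU.mem_nhds hy] with z hz using
        ((hh.contDiffAt (hU.mem_nhds hz)).differentiableAt (by simp)).hasFDerivAt) (d1 y hy) a b
  have sym2 : ∀ a b, D3 x a b = D3 x b a := fun a b =>
    second_derivative_symmetric_of_eventually (f := D1) (f' := D2) (x := x)
      (by filter_upwards [hUx] with z hz using d1 z hz) (d2 x hx) a b
  have p : ∀ a b : V, HasFDerivAt (fun y => D2 y a b) (((D3 x).flip a).flip b) x := by
    intro a b
    have := ((d2 x hx).clm_apply (hasFDerivAt_const a x)).clm_apply (hasFDerivAt_const b x)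
    convert! this using 1
    ext z
    simp
  have sec : fderiv ℝ (fderiv ℝ (fun y => D1 y y)) x e e = D3 x e e x + 2 * D2 x e e := by
    have h1 : fderiv ℝ (fun y => D1 y y) =ᶠ[nhds x] fun y => D2 y y + D1 y := by
      filter_upwards [hUx] with y hy
      have := ((d1 y hy).clm_apply (hasFDerivAt_id y)).fderiv
      rw [show (fun y => D1 y y) = fun y => D1 y (id y) from rfl, this]
      ext z
      simp [add_comm, sym1 y hy z y]
    rw [h1.fderiv_eq]
    have h3 := ((d2 x hx).clm_apply (hasFDerivAt_id x)).add (d1 x hx)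
    have h4 := h3.fderiv
    rw [show (fun y => D2 y y + D1 y) = (fun y => D2 y (id y)) + D1 from rfl, h4]
    have heq : (fun y => D2 y e x) =ᶠ[nhds x] fun y => D2 y x e := by
      filter_upwards [hUx] with y hy using sym1 y hy e x
    have q := DFunLike.congr_fun (((p x e).congr_of_eventuallyEq heq).unique (p e x)) e
    simp at q
    simp
    rw [q]
    ring
  have heq : (fun y => D2 y e x) =ᶠ[nhds x] fun y => D2 y x e := by
    filter_upwards [hUx] with y hy using sym1 y hy e x
  have q := DFunLike.congr_fun (((p x e).congr_of_eventuallyEq heq).unique (p e x)) e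
  simp at q
  refine ⟨(p e e).differentiableAt, ?_⟩
  rw [sec, (p e e).fderiv, ← q, sym2 e x]
  simp

lemma euler_harmonic {d : ℕ} {h : Euc d → ℝ} {U : Set (Euc d)} (hU : IsOpen U)
    (hh : ContDiffOn ℝ 4 h U) (hl : ∀ x ∈ U, L2 h x = 0) :
    ContDiffOn ℝ 2 (fun y => fderiv ℝ h y y) U ∧ ∀ x ∈ U, L2 (fun y => fderiv ℝ h y y) x = 0 := by
  have c1 : ContDiffOn ℝ 3 (fderiv ℝ h) U := hh.fderiv_of_isOpen hU (by norm_num)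
  have cv : ContDiffOn ℝ 2 (fun y => fderiv ℝ h y y) U := (c1.of_le (by norm_num)).clm_apply contDiffOn_id
  refine ⟨cv, fun x hx => ?_⟩
  have hUx := hU.mem_nhds hx
  have hz : ∑ i : Fin d, fderiv ℝ (fun y => fderiv ℝ (fderiv ℝ h) y (ee i) (ee i)) x x = 0 := by
    have p := HasFDerivAt.fun_sum (u := Finset.univ) fun (i : Fin d) _ => (euler_second hU hh x hx (ee i)).1.hasFDerivAt
    have heq : (fun y => ∑ i : Fin d, fderiv ℝ (fderiv ℝ h) y (ee i) (ee i)) =ᶠ[nhds x] fun y => 0 := by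
      filter_upwards [hUx] with y hy using hl y hy
    have := ((hasFDerivAt_const (0:ℝ) x).congr_of_eventuallyEq heq).unique p
    have q := DFunLike.congr_fun this x
    simpa using q.symm
  have hlx := hl x hx
  unfold L2 at hlx ⊢
  rw [Finset.sum_congr rfl fun i _ => (euler_second hU hh x hx (ee i)).2,
    Finset.sum_add_distrib, hz, ← Finset.mul_sum, hlx]
  simp

lemma neumann {d : ℕ} (hd : 0 < d) {δ : ℝ} (hδ : 0 < δ) {h : Euc d → ℝ} {U : Set (Euc d)} (hU : IsOpen U)
    (hsub : closedBall 0 δ ⊆ U) (hh : ContDiffOn ℝ 4 h U) (hl : ∀ x ∈ U, L2 h x = 0)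
    (h0 : ∀ x ∈ sphere (0 : Euc d) δ, fderiv ℝ h x x = 0) :
    ∀ x ∈ closedBall (0 : Euc d) δ, h x = h 0 := by
  obtain ⟨e1, e2⟩ := euler_harmonic hU hh hl
  have hz := max_zero_L2 hd hδ hU hsub e1 e2 h0
  intro x hx
  have hmem : ∀ t ∈ Set.Icc (0:ℝ) 1, t • x ∈ closedBall (0 : Euc d) δ := by
    intro t ht
    simp [norm_smul] at hx ⊢
    rw [abs_of_nonneg ht.1]
    nlinarith [norm_nonneg x, ht.1, ht.2]
  have hder : ∀ t ∈ Set.Icc (0:ℝ) 1, HasDerivAt (fun s : ℝ => h (0 + s • x)) (fderiv ℝ h (0 + t • x) x) t :=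
    fun t ht => hasDerivAt_line ((hh.contDiffAt (hU.mem_nhds (hsub (by simpa using hmem t ht)))).differentiableAt (by simp))
  obtain ⟨c, hc, hc2⟩ := exists_hasDerivAt_eq_slope (fun s : ℝ => h (0 + s • x)) _ (zero_lt_one' ℝ)
    (fun t ht => (hder t ht).continuousAt.continuousWithinAt) (fun t ht => hder t ⟨ht.1.le, ht.2.le⟩)
  have h3 := hz _ (hmem c ⟨hc.1.le, hc.2.le⟩)
  simp only [map_smul, smul_eq_mul, mul_eq_zero, hc.1.ne', false_or] at h3
  simp only [zero_add] at hc2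
  rw [h3] at hc2
  simp at hc2
  linarith


/-- coordinate projection -/
def sProj {n : ℕ} (i : Fin (n+1)) (y : Euc (n+1)) : Fin n → ℝ := fun j => y (i.succAbove j)

/-- local section of the sphere -/
def sSec {n : ℕ} (i : Fin (n+1)) (σ δ : ℝ) (z : Fin n → ℝ) : Euc (n+1) :=
  WithLp.toLp 2 (i.insertNth (σ * Real.sqrt (δ ^ 2 - ∑ j, z j ^ 2)) z : Fin (n+1) → ℝ)

lemma sProj_lip {n : ℕ} (i : Fin (n+1)) : LipschitzWith 1 (sProj (n := n) i) := by
  refine LipschitzWith.of_dist_le_mul fun x y => ?_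
  simp only [NNReal.coe_one, one_mul]
  refine (dist_pi_le_iff dist_nonneg).2 fun j => ?_
  rw [EuclideanSpace.dist_eq]
  refine Real.le_sqrt_of_sq_le ?_
  exact Finset.single_le_sum (f := fun k => dist (x k) (y k) ^ 2) (fun k _ => sq_nonneg _) (Finset.mem_univ (i.succAbove j))

lemma sProj_sSec {n : ℕ} (i : Fin (n+1)) (σ δ : ℝ) (z : Fin n → ℝ) : sProj i (sSec i σ δ z) = z := by
  funext j
  simp [sProj, sSec]

lemma sSec_mem {n : ℕ} (i : Fin (n+1)) {σ δ : ℝ} (hσ : σ ^ 2 = 1) (hδ : 0 < δ) {z : Fin n → ℝ}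
    (hz : ∑ j, z j ^ 2 < δ ^ 2) : sSec i σ δ z ∈ sphere (0 : Euc (n+1)) δ := by
  rw [mem_sphere_zero_iff_norm, EuclideanSpace.norm_eq, Fin.sum_univ_succAbove _ i]
  simp only [sSec, Real.norm_eq_abs, sq_abs, Fin.insertNth_apply_same, Fin.insertNth_apply_succAbove, mul_pow, hσ]
  rw [Real.sq_sqrt (by linarith)]
  ring_nf
  exact Real.sqrt_sq hδ.le

lemma sSec_sProj {n : ℕ} (i : Fin (n+1)) {σ δ : ℝ} (hσ : σ ^ 2 = 1) {y : Euc (n+1)}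
    (hy : y ∈ sphere (0 : Euc (n+1)) δ) (hp : 0 < σ * y i) :
    sSec i σ δ (sProj i y) = y ∧ ∑ j, sProj i y j ^ 2 < δ ^ 2 := by
  have h1 : δ ^ 2 = y i ^ 2 + ∑ j, sProj i y j ^ 2 := by
    rw [mem_sphere_zero_iff_norm] at hy
    rw [← hy, EuclideanSpace.real_norm_sq_eq, Fin.sum_univ_succAbove _ i]
    rfl
  have h2 : δ ^ 2 - ∑ j, sProj i y j ^ 2 = (σ * y i) ^ 2 := by rw [mul_pow, hσ]; linarith
  constructor
  · unfold sSec
    rw [h2, Real.sqrt_sq hp.le]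
    ext k
    refine Fin.succAboveCases i ?_ (fun j => ?_) k
    · simp only [Fin.insertNth_apply_same]
      rw [← mul_assoc, ← sq, hσ, one_mul]
    · simp [sProj]
  · have : 0 < (σ * y i) ^ 2 := by positivity
    linarith

lemma sSec_contDiffAt {n : ℕ} (i : Fin (n+1)) {σ δ : ℝ} {z : Fin n → ℝ}
    (hz : ∑ j, z j ^ 2 < δ ^ 2) : ContDiffAt ℝ 1 (sSec i σ δ) z := by
  rw [contDiffAt_euclidean]
  intro k
  refine Fin.succAboveCases i ?_ (fun j => ?_) k
  · simp only [sSec, Fin.insertNth_apply_same]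
    refine contDiffAt_const.mul (ContDiffAt.sqrt ?_ (by linarith))
    fun_prop
  · simp only [sSec, Fin.insertNth_apply_succAbove]
    fun_prop

lemma exists_chart {n : ℕ} {δ : ℝ} (hδ : 0 < δ) {y : Euc (n+1)} (hy : y ∈ sphere (0 : Euc (n+1)) δ) :
    ∃ (i : Fin (n+1)) (σ : ℝ), σ ^ 2 = 1 ∧ 0 < σ * y i := by
  have : ∃ i, y i ≠ 0 := by
    by_contra! h
    have : y = 0 := by ext i; simpa using h i
    subst this
    simp at hy
    linarith
  obtain ⟨i, hi⟩ := this
  rcases lt_or_gt_of_ne hi with h | h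
  · exact ⟨i, -1, by norm_num, by linarith⟩
  · exact ⟨i, 1, by norm_num, by linarith⟩

lemma cap_pos {n : ℕ} {δ : ℝ} (hδ : 0 < δ) {y : Euc (n+1)} (hy : y ∈ sphere (0 : Euc (n+1)) δ)
    {V : Set (Euc (n+1))} (hV : V ∈ nhds y) : 0 < μH[(n : ℝ)] (V ∩ sphere (0 : Euc (n+1)) δ) := by
  obtain ⟨i, σ, hσ, hp⟩ := exists_chart hδ hy
  obtain ⟨e1, e2⟩ := sSec_sProj i hσ hy hp
  have hc : ContinuousAt (sSec i σ δ) (sProj i y) := (sSec_contDiffAt i e2).continuousAt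
  have h1 : ∀ᶠ z in nhds (sProj i y), sSec i σ δ z ∈ V := hc.eventually (by rw [e1]; exact hV)
  have h2 : ∀ᶠ z in nhds (sProj i y), ∑ j, z j ^ 2 < δ ^ 2 := by
    have : Continuous (fun z : Fin n → ℝ => ∑ j, z j ^ 2) := by fun_prop
    exact this.continuousAt.eventually_lt continuousAt_const e2
  have h3 : {z | sSec i σ δ z ∈ V ∧ ∑ j, z j ^ 2 < δ ^ 2} ∈ nhds (sProj i y) := h1.and h2
  have h4 : {z | sSec i σ δ z ∈ V ∧ ∑ j, z j ^ 2 < δ ^ 2} ⊆ sProj i '' (V ∩ sphere (0 : Euc (n+1)) δ) := by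
    rintro z ⟨hz1, hz2⟩
    exact ⟨sSec i σ δ z, ⟨hz1, sSec_mem i hσ hδ hz2⟩, sProj_sSec i σ δ z⟩
  have h5 : 0 < (volume : Measure (Fin n → ℝ)) (sProj i '' (V ∩ sphere (0 : Euc (n+1)) δ)) :=
    Measure.measure_pos_of_mem_nhds _ (mem_of_superset h3 h4)
  rw [← hausdorffMeasure_pi_real, Fintype.card_fin] at h5
  refine h5.trans_le ?_
  simpa using (sProj_lip i).hausdorffMeasure_image_le (d := (n:ℝ)) (by positivity) (V ∩ sphere (0 : Euc (n+1)) δ)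

lemma sphere_finite {n : ℕ} {δ : ℝ} (hδ : 0 < δ) : μH[(n : ℝ)] (sphere (0 : Euc (n+1)) δ) < ∞ := by
  refine (isCompact_sphere _ _).measure_lt_top_of_nhdsWithin fun y hy => ?_
  obtain ⟨i, σ, hσ, hp⟩ := exists_chart hδ hy
  obtain ⟨e1, e2⟩ := sSec_sProj i hσ hy hp
  obtain ⟨K, t, ht, hl⟩ := (sSec_contDiffAt (σ := σ) i e2).exists_lipschitzOnWith
  set t' := t ∩ ball (sProj i y) 1
  have ht' : t' ∈ nhds (sProj i y) := inter_mem ht (ball_mem_nhds _ one_pos)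
  have hfin : μH[(n : ℝ)] (sSec i σ δ '' t') < ∞ := by
    refine ((hl.mono Set.inter_subset_left).hausdorffMeasure_image_le (d := (n:ℝ)) (by positivity)).trans_lt ?_
    refine ENNReal.mul_lt_top (by simp) ?_
    have : μH[(n : ℝ)] = (volume : Measure (Fin n → ℝ)) := by rw [← hausdorffMeasure_pi_real, Fintype.card_fin]
    rw [this]
    exact (measure_mono Set.inter_subset_right).trans_lt measure_ball_lt_top
  refine ⟨sSec i σ δ '' t', ?_, hfin⟩
  have a1 : ∀ᶠ w in nhdsWithin y (sphere 0 δ), sProj i w ∈ t' :=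
    nhdsWithin_le_nhds ((sProj_lip i).continuous.continuousAt ht')
  have a2 : ∀ᶠ w : Euc (n+1) in nhdsWithin y (sphere 0 δ), 0 < σ * w i := by
    refine nhdsWithin_le_nhds ?_
    have : Continuous (fun w : Euc (n+1) => σ * w i) := by fun_prop
    exact continuousAt_const.eventually_lt this.continuousAt hp
  filter_upwards [a1, a2, self_mem_nhdsWithin] with w h1 h2 h3
  exact ⟨sProj i w, h1, (sSec_sProj i hσ h3 h2).1⟩

lemma sm_eq {n : ℕ} (δ : ℝ) : sphereMeasure (0 : Euc (n+1)) δ = (μH[(n : ℝ)]).restrict (sphere 0 δ) := by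
  unfold sphereMeasure
  congr 2
  push_cast
  ring

lemma sm_finite {d : ℕ} (hd : 0 < d) {δ : ℝ} (hδ : 0 < δ) : IsFiniteMeasure (sphereMeasure (0 : Euc d) δ) := by
  obtain ⟨n, rfl⟩ : ∃ n, d = n + 1 := ⟨d - 1, by omega⟩
  rw [sm_eq]
  exact ⟨by simpa using sphere_finite hδ⟩

/-- a continuous function on the sphere whose square integrates to zero vanishes -/
lemma sm_zero {d : ℕ} (hd : 0 < d) {δ : ℝ} (hδ : 0 < δ) {v : Euc d → ℝ} (hv : ContinuousOn v (sphere 0 δ))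
    (h0 : ∫ y, v y * v y ∂(sphereMeasure (0 : Euc d) δ) = 0) : ∀ y ∈ sphere (0 : Euc d) δ, v y = 0 := by
  have := sm_finite hd hδ
  have hint : Integrable (fun y => v y * v y) (sphereMeasure (0 : Euc d) δ) := by
    have h := (hv.mul hv).integrableOn_compact (μ := sphereMeasure (0 : Euc d) δ) (isCompact_sphere _ _)
    unfold sphereMeasure at h ⊢
    rwa [IntegrableOn, Measure.restrict_restrict isClosed_sphere.measurableSet, Set.inter_self] at h
  rw [integral_eq_zero_iff_of_nonneg (fun y => mul_self_nonneg _) hint] at h0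
  obtain ⟨n, rfl⟩ : ∃ n, d = n + 1 := ⟨d - 1, by omega⟩
  intro y hy
  by_contra hne
  have h1 : ∀ᶠ w in nhdsWithin y (sphere 0 δ), v w ≠ 0 := (hv y hy).eventually_ne hne
  rw [eventually_iff, mem_nhdsWithin_iff_exists_mem_nhds_inter] at h1
  obtain ⟨V, hV, hsub⟩ := h1
  have h2 := cap_pos hδ hy hV
  rw [sm_eq, Filter.EventuallyEq, ae_restrict_iff' isClosed_sphere.measurableSet] at h0
  have h3 : μH[(n : ℝ)] (V ∩ sphere (0 : Euc (n+1)) δ) = 0 := by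
    refine measure_mono_null ?_ h0
    intro w hw
    have := hsub hw
    simp only [Set.mem_compl_iff, Set.mem_ofPred_eq] at this ⊢
    intro hc
    have := hc hw.2
    simp at this
    contradiction
  exact h2.ne' h3


lemma ibp {d : ℕ} {f ψ : Euc d → ℝ} (hf : ContDiff ℝ 2 f) (hψ : ContDiff ℝ 2 ψ) (hs : HasCompactSupport f) :
    ∫ y, ψ y * L2 f y = ∫ y, L2 ψ y * f y := by
  have F1 : ∀ {g : Euc d → ℝ}, ContDiff ℝ 2 g → ∀ e, ContDiff ℝ 1 (fun y => fderiv ℝ g y e) := fun hg e =>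
    (hg.fderiv_right (m := 1) (by norm_num)).clm_apply contDiff_const
  have F2 : ∀ {g : Euc d → ℝ}, ContDiff ℝ 2 g → ∀ e y, fderiv ℝ (fun y => fderiv ℝ g y e) y e = fderiv ℝ (fderiv ℝ g) y e e := by
    intro g hg e y
    have hd : DifferentiableAt ℝ (fderiv ℝ g) y :=
      (hg.fderiv_right (m := 1) (by norm_num)).differentiable (by simp) y
    have := (hd.hasFDerivAt.clm_apply (hasFDerivAt_const e y)).fderiv
    rw [this]
    simp
  have F3 : ∀ {g : Euc d → ℝ}, ContDiff ℝ 2 g → ∀ e, Continuous (fun y => fderiv ℝ (fderiv ℝ g) y e e) := by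
    intro g hg e
    have := ((F1 hg e).continuous_fderiv (by simp)).clm_apply (continuous_const (y := e))
    simpa only [F2 hg e] using this
  have s1 : ∀ e, HasCompactSupport (fun y => fderiv ℝ f y e) := fun e => hs.fderiv_apply (𝕜 := ℝ) e
  have s2 : ∀ e, HasCompactSupport (fun y => fderiv ℝ (fderiv ℝ f) y e e) := fun e => by
    have := (s1 e).fderiv_apply (𝕜 := ℝ) e
    simpa only [F2 hf e] using this
  have I1 : ∀ {u w : Euc d → ℝ}, Continuous u → Continuous w → HasCompactSupport w → Integrable (fun y => u y * w y) :=
    fun hu hw hc => (hu.mul hw).integrable_of_hasCompactSupport hc.mul_left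
  unfold L2
  simp only [Finset.mul_sum, Finset.sum_mul]
  rw [integral_finsetSum _ fun i _ => I1 hψ.continuous (F3 hf _) (s2 _),
    integral_finsetSum _ fun i _ => I1 (F3 hψ _) hf.continuous hs]
  refine Finset.sum_congr rfl fun i _ => ?_
  have a := integral_mul_fderiv_eq_neg_fderiv_mul_of_integrable (μ := volume) (f := ψ) (g := fun y => fderiv ℝ f y (ee i)) (v := ee i)
    (I1 (F1 hψ _).continuous (F1 hf _).continuous (s1 _)) 
    (by simp only [F2 hf]; exact I1 hψ.continuous (F3 hf _) (s2 _))
    (I1 hψ.continuous (F1 hf _).continuous (s1 _))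
    (fun y _ => hψ.differentiable (by simp) y) (fun y _ => (F1 hf _).differentiable (by simp) y)
  have b := integral_mul_fderiv_eq_neg_fderiv_mul_of_integrable (μ := volume) (f := fun y => fderiv ℝ ψ y (ee i)) (g := f) (v := ee i)
    (by simp only [F2 hψ]; exact I1 (F3 hψ _) hf.continuous hs)
    (I1 (F1 hψ _).continuous (F1 hf _).continuous (s1 _)) 
    (I1 (F1 hψ _).continuous hf.continuous hs)
    (fun y _ => (F1 hψ _).differentiable (by simp) y) (fun y _ => hf.differentiable (by simp) y)
  simp only [F2 hf] at a
  simp only [F2 hψ] at b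
  rw [a, b, neg_neg]

/-- smoothness and derivative assumption on the radial profile -/
structure Prof (d : ℕ) (G : ℝ → ℝ) (c : ℝ) : Prop where
  hd : ∀ s > 0, HasDerivAt G (-c * s ^ (-(d:ℝ)/2)) s
  hs : ∀ s > 0, ContDiffAt ℝ 2 G s
  hc : c ≠ 0

lemma prof_contDiffAt {d : ℕ} {G : ℝ → ℝ} {c : ℝ} (hG : Prof d G c) (x y : Euc d) (τ : ℝ)
    (h : 0 < ‖x - y‖ ^ 2 + τ) : ContDiffAt ℝ 2 (fun y => G (‖x - y‖ ^ 2 + τ)) y := by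
  refine ContDiffAt.comp (g := G) (f := fun y => ‖x - y‖ ^ 2 + τ) y (hG.hs _ h) ?_
  exact (((contDiff_const.sub contDiff_id).norm_sq ℝ).add contDiff_const).contDiffAt

lemma prof_L2 {d : ℕ} {G : ℝ → ℝ} {c : ℝ} (hG : Prof d G c) (x y : Euc d) (τ : ℝ)
    (h : 0 < ‖x - y‖ ^ 2 + τ) : L2 (fun y => G (‖x - y‖ ^ 2 + τ)) y 
      = -2 * c * d * τ * (‖x - y‖ ^ 2 + τ) ^ (-(d:ℝ)/2 - 1) := by
  have key : ∀ i : Fin d, fderiv ℝ (fderiv ℝ (fun y => G (‖x - y‖ ^ 2 + τ))) y (ee i) (ee i) =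
      2 * c * d * (x i - y i) ^ 2 * (‖x - y‖ ^ 2 + τ) ^ (-(d:ℝ)/2 - 1) - 2 * c * (‖x - y‖ ^ 2 + τ) ^ (-(d:ℝ)/2) := by
    intro i
    rw [← (second_line (prof_contDiffAt hG x y τ h)).2.deriv]
    set b := x i - y i with hb
    have e1 : ∀ s : ℝ, ‖x - (y + s • ee i)‖ ^ 2 + τ = (‖x - y‖ ^ 2 + τ) - 2 * (s * b) + s ^ 2 := by
      intro s
      rw [← sub_sub, norm_sub_sq_real, inner_smul_right, norm_smul]
      simp [EuclideanSpace.inner_single_right, hb]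
      ring
    simp only [e1]
    set N := ‖x - y‖ ^ 2 + τ
    have q : ∀ s : ℝ, HasDerivAt (fun s : ℝ => N - 2 * (s * b) + s ^ 2) (2 * s - 2 * b) s := by
      intro s
      have := ((((hasDerivAt_id s).mul_const b).const_mul 2).const_sub N).add ((hasDerivAt_id s).pow 2)
      convert! this using 1
      simp
      ring
    have hpos : ∀ᶠ s : ℝ in nhds 0, 0 < N - 2 * (s * b) + s ^ 2 := by
      refine continuousAt_const.eventually_lt (q 0).continuousAt ?_
      simpa using h
    have h1 : deriv (fun s : ℝ => G (N - 2 * (s * b) + s ^ 2)) =ᶠ[nhds 0]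
        fun s => -c * (N - 2 * (s * b) + s ^ 2) ^ (-(d:ℝ)/2) * (2 * s - 2 * b) := by
      filter_upwards [hpos] with s hs
      exact ((hG.hd _ hs).comp s (q s)).deriv
    rw [h1.deriv_eq]
    have h2 : HasDerivAt (fun s : ℝ => (N - 2 * (s * b) + s ^ 2) ^ (-(d:ℝ)/2)) ((2 * 0 - 2 * b) * (-(d:ℝ)/2) * (N - 2 * (0 * b) + 0 ^ 2) ^ (-(d:ℝ)/2 - 1)) 0 :=
      (q 0).rpow_const (Or.inl (by simpa using h.ne'))
    have h3 : HasDerivAt (fun s : ℝ => 2 * s - 2 * b) (2 * 1) 0 := ((hasDerivAt_id (0:ℝ)).const_mul 2).sub_const _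
    have h4 := ((h2.const_mul (-c)).mul h3).deriv
    refine h4.trans ?_
    simp
    ring
  unfold L2
  simp only [key]
  rw [Finset.sum_sub_distrib, ← Finset.sum_mul, ← Finset.mul_sum]
  have hn : ∑ i : Fin d, (x i - y i) ^ 2 = ‖x - y‖ ^ 2 := by
    rw [EuclideanSpace.real_norm_sq_eq]; rfl
  rw [hn]
  have hp : (‖x - y‖ ^ 2 + τ) ^ (-(d:ℝ)/2) = (‖x - y‖ ^ 2 + τ) ^ (-(d:ℝ)/2 - 1) * (‖x - y‖ ^ 2 + τ) := by
    conv_rhs => rw [← Real.rpow_add_one h.ne']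
    congr 1; ring
  simp [hp]
  ring

lemma L2_continuous {d : ℕ} {f : Euc d → ℝ} (hf : ContDiff ℝ 2 f) : Continuous (L2 f) := by
  have c1 : ContDiff ℝ 1 (fderiv ℝ f) := hf.fderiv_right (m := 1) (by norm_num)
  have c2 := c1.continuous_fderiv (by simp)
  unfold L2
  exact continuous_finsetSum _ fun i _ => (c2.clm_apply continuous_const).clm_apply continuous_const

lemma L2_support {d : ℕ} {f : Euc d → ℝ} {x : Euc d} (h : f =ᶠ[nhds x] 0) : L2 f x = 0 := by
  rw [L2_congr h]
  simp [L2]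

lemma L2_compact {d : ℕ} {f : Euc d → ℝ} (hs : HasCompactSupport f) : HasCompactSupport (L2 f) := by
  refine HasCompactSupport.intro hs fun x hx => L2_support ?_
  exact notMem_tsupport_iff_eventuallyEq.1 hx

def newtI (d : ℕ) : ℝ := ∫ z : Euc d, ((1:ℝ) + ‖z‖ ^ 2) ^ (-((d:ℝ) + 2) / 2)

lemma newt_int (d : ℕ) : Integrable (fun z : Euc d => ((1:ℝ) + ‖z‖ ^ 2) ^ (-((d:ℝ) + 2) / 2)) :=
  integrable_rpow_neg_one_add_norm_sq (by simp)

lemma newtI_pos (d : ℕ) : 0 < newtI d := by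
  unfold newtI
  rw [integral_pos_iff_support_of_nonneg (fun z => by positivity) (newt_int d)]
  have : Function.support (fun z : Euc d => ((1:ℝ) + ‖z‖ ^ 2) ^ (-((d:ℝ) + 2) / 2)) = Set.univ := by
    ext z
    simp only [Function.mem_support, Set.mem_univ, iff_true]
    positivity
  rw [this]
  exact Measure.measure_univ_pos.2 (NeZero.ne _)

lemma newton_reg {d : ℕ} {G : ℝ → ℝ} {c : ℝ} (hG : Prof d G c) {f : Euc d → ℝ} (hf : ContDiff ℝ 2 f) (hs : HasCompactSupport f)
    (x : Euc d) {η : ℝ} (hη : 0 < η) :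
    ∫ y, G (‖x - y‖ ^ 2 + η ^ 2) * L2 f y = 
      -2 * c * d * ∫ z : Euc d, ((1:ℝ) + ‖z‖ ^ 2) ^ (-((d:ℝ) + 2) / 2) * f (x + η • z) := by
  have hpos : ∀ y, 0 < ‖x - y‖ ^ 2 + η ^ 2 := fun y => by positivity
  have hψ : ContDiff ℝ 2 (fun y => G (‖x - y‖ ^ 2 + η ^ 2)) := contDiff_iff_contDiffAt.2 fun y => 
    prof_contDiffAt hG x y _ (hpos y)
  rw [ibp hf hψ hs]
  simp only [fun y => prof_L2 hG x y _ (hpos y)]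
  rw [← integral_add_left_eq_self _ x]
  have h1 := Measure.integral_comp_smul (volume : Measure (Euc d)) (fun w => 
    -2 * c * d * η ^ 2 * (‖x - (x + w)‖ ^ 2 + η ^ 2) ^ (-(d:ℝ)/2 - 1) * f (x + w)) η
  have hfr : Module.finrank ℝ (Euc d) = d := by simp
  rw [hfr, abs_of_pos (by positivity), smul_eq_mul] at h1
  have h2 : ∫ w, -2 * c * d * η ^ 2 * (‖x - (x + w)‖ ^ 2 + η ^ 2) ^ (-(d:ℝ)/2 - 1) * f (x + w) =
     η ^ d * ∫ z : Euc d, -2 * c * d * η ^ 2 * (‖x - (x + η • z)‖ ^ 2 + η ^ 2) ^ (-(d:ℝ)/2 - 1) * f (x + η • z) := by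
    rw [h1, ← mul_assoc, mul_inv_cancel₀ (by positivity), one_mul]
  rw [h2, ← integral_const_mul, ← integral_const_mul]
  congr 1
  funext z
  have h3 : ‖x - (x + η • z)‖ ^ 2 + η ^ 2 = η ^ 2 * (1 + ‖z‖ ^ 2) := by
    have : x - (x + η • z) = -(η • z) := by abel
    rw [this, norm_neg, norm_smul, Real.norm_of_nonneg hη.le]; ring
  rw [h3, Real.mul_rpow (by positivity) (by positivity)]
  have h4 : η ^ d * η ^ 2 * (η ^ 2) ^ (-(d:ℝ)/2 - 1) = 1 := by
    rw [← pow_add, ← Real.rpow_natCast, ← Real.rpow_natCast η 2, ← Real.rpow_mul hη.le, ← Real.rpow_add hη]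
    push_cast
    ring_nf
    simp
  rw [show -((d:ℝ) + 2) / 2 = -(d:ℝ)/2 - 1 by ring]
  linear_combination (-2 * c * d * (1 + ‖z‖ ^ 2) ^ (-(d:ℝ)/2 - 1) * f (x + η • z)) * h4

lemma newton {d : ℕ} {G : ℝ → ℝ} {c : ℝ} (hG : Prof d G c) {f : Euc d → ℝ} (hf : ContDiff ℝ 2 f) (hs : HasCompactSupport f)
    (x : Euc d) (hx : L2 f =ᶠ[nhds x] 0) :
    ∫ y, G (‖x - y‖ ^ 2) * L2 f y = -2 * c * d * newtI d * f x := by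
  have lim1 : Tendsto (fun η : ℝ => ∫ y, G (‖x - y‖ ^ 2 + η ^ 2) * L2 f y) (nhdsWithin 0 (Set.Ioi 0)) 
      (nhds (∫ y, G (‖x - y‖ ^ 2) * L2 f y)) := by
    have hc : Continuous (Function.uncurry fun (η : ℝ) (y : Euc d) => G (‖x - y‖ ^ 2 + η ^ 2) * L2 f y) := by
      rw [continuous_iff_continuousAt]
      rintro ⟨η, y⟩
      by_cases hy : y = x
      · subst hy
        have : (Function.uncurry fun (η : ℝ) (w : Euc d) => G (‖y - w‖ ^ 2 + η ^ 2) * L2 f w) =ᶠ[nhds (η, y)] fun _ => 0 := by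
          filter_upwards [(continuous_snd.tendsto (η, y)).eventually hx] with p hp
          simp [Function.uncurry, hp]
        exact continuousAt_const.congr this.symm
      · have hp : 0 < ‖x - y‖ ^ 2 + η ^ 2 := by
          have : 0 < ‖x - y‖ := norm_pos_iff.2 (sub_ne_zero.2 (Ne.symm hy))
          positivity
        refine ContinuousAt.mul (f := fun p : ℝ × Euc d => G (‖x - p.2‖ ^ 2 + p.1 ^ 2)) (g := fun p : ℝ × Euc d => L2 f p.2) ?_ ?_
        · refine ContinuousAt.comp (g := G) (f := fun p : ℝ × Euc d => ‖x - p.2‖ ^ 2 + p.1 ^ 2) (hG.hs _ hp).continuousAt ?_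
          fun_prop
        · exact ((L2_continuous hf).comp continuous_snd).continuousAt
    have hcomp := L2_compact hs
    have h1 := continuous_parametric_integral_of_continuous (μ := (volume : Measure (Euc d))) hc hcomp
    have h2 : ∀ η : ℝ, ∫ y in tsupport (L2 f), G (‖x - y‖ ^ 2 + η ^ 2) * L2 f y = ∫ y, G (‖x - y‖ ^ 2 + η ^ 2) * L2 f y := by
      intro η
      refine setIntegral_eq_integral_of_forall_compl_eq_zero fun y hy => ?_
      rw [image_eq_zero_of_notMem_tsupport hy, mul_zero]
    simp only [h2] at h1
    have := (h1.tendsto 0).mono_left (nhdsWithin_le_nhds (s := Set.Ioi 0))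
    simpa using this
  have lim2 : Tendsto (fun η : ℝ => ∫ z : Euc d, ((1:ℝ) + ‖z‖ ^ 2) ^ (-((d:ℝ) + 2) / 2) * f (x + η • z)) (nhdsWithin 0 (Set.Ioi 0))
      (nhds (newtI d * f x)) := by
    unfold newtI
    rw [← integral_mul_const]
    obtain ⟨M, hM⟩ := hs.exists_bound_of_continuous hf.continuous
    refine tendsto_integral_filter_of_dominated_convergence (fun z => ((1:ℝ) + ‖z‖ ^ 2) ^ (-((d:ℝ) + 2) / 2) * M) ?_ ?_ ((newt_int d).mul_const M) ?_
    · refine Eventually.of_forall fun η => ?_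
      exact (newt_int d).aestronglyMeasurable.mul (hf.continuous.comp (by fun_prop)).aestronglyMeasurable
    · refine Eventually.of_forall fun η => Eventually.of_forall fun z => ?_
      rw [norm_mul, Real.norm_of_nonneg (by positivity)]
      gcongr
      exact hM _
    · refine Eventually.of_forall fun z => ?_
      have : Continuous (fun η : ℝ => ((1:ℝ) + ‖z‖ ^ 2) ^ (-((d:ℝ) + 2) / 2) * f (x + η • z)) := by
        have := hf.continuous
        fun_prop
      have := (this.tendsto 0).mono_left (nhdsWithin_le_nhds (s := Set.Ioi 0))
      simpa using this
  have lim3 := lim2.const_mul (-2 * c * d)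
  have := tendsto_nhds_unique (lim1.congr' (by 
    filter_upwards [self_mem_nhdsWithin] with η hη using newton_reg hG hf hs x hη)) lim3
  rw [this]; ring

lemma int_L2_zero {d : ℕ} {f : Euc d → ℝ} (hf : ContDiff ℝ 2 f) (hs : HasCompactSupport f) : ∫ y, L2 f y = 0 := by
  have := ibp hf (ψ := fun _ => 1) contDiff_const hs
  simpa [L2] using this

open scoped BoundedContinuousFunction


section logs
variable {X : Type*} [TopologicalSpace X]

/-- series of `-log (1 - p)` -/
def serS (p : X →ᵇ ℝ) : X →ᵇ ℝ := (FormalMultilinearSeries.ofScalars (X →ᵇ ℝ) (fun n : ℕ => ((n : ℝ))⁻¹)).sum p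

lemma ser_radius : 1 ≤ (FormalMultilinearSeries.ofScalars (X →ᵇ ℝ) (fun n : ℕ => ((n : ℝ))⁻¹)).radius := by
  refine FormalMultilinearSeries.le_radius_of_bound (r := 1) _ 1 fun n => ?_
  rcases Nat.eq_zero_or_pos n with h | h
  · subst h
    rw [FormalMultilinearSeries.ofScalars_eq_zero_of_scalar_zero _ (by simp)]
    simp
  · have := FormalMultilinearSeries.ofScalars_norm_le (E := X →ᵇ ℝ) (fun n : ℕ => ((n : ℝ))⁻¹) n h
    simp only [NNReal.coe_one, one_pow, mul_one]
    refine this.trans ?_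
    rw [norm_inv, Real.norm_natCast]
    exact inv_le_one_of_one_le₀ (by exact_mod_cast h)

lemma serS_ball : HasFPowerSeriesOnBall (serS (X := X)) (FormalMultilinearSeries.ofScalars (X →ᵇ ℝ) (fun n : ℕ => ((n : ℝ))⁻¹)) 0 
    (FormalMultilinearSeries.ofScalars (X →ᵇ ℝ) (fun n : ℕ => ((n : ℝ))⁻¹)).radius :=
  FormalMultilinearSeries.hasFPowerSeriesOnBall _ (lt_of_lt_of_le one_pos ser_radius)

lemma serS_apply {p : X →ᵇ ℝ} (hp : ‖p‖ < 1) (x : X) : serS p x = - Real.log (1 - p x) := by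
  have h1 := (serS_ball (X := X)).hasSum (y := p) (by
    rw [mem_eball_zero_iff]
    refine lt_of_lt_of_le ?_ ser_radius
    rw [← ofReal_norm]
    exact ENNReal.ofReal_lt_one.2 hp)
  have h2 := h1.mapL (BoundedContinuousFunction.evalCLM ℝ x)
  rw [zero_add] at h2
  have hx : |p x| < 1 := (p.norm_coe_le_norm x).trans_lt hp
  have h3 := Real.hasSum_pow_div_log_of_abs_lt_one hx
  have h4 : HasSum (fun n : ℕ => ((n:ℝ))⁻¹ * p x ^ n) (-Real.log (1 - p x)) := by
    rw [← hasSum_nat_add_iff' 1]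
    simp only [Finset.range_one, Finset.sum_singleton, Nat.cast_zero, inv_zero, zero_mul, sub_zero]
    convert! h3 using 2
    push_cast
    field_simp
  refine HasSum.unique ?_ h4
  convert! h2 using 2
  rw [FormalMultilinearSeries.ofScalars_apply_eq]
  simp

open Classical in
/-- pointwise logarithm -/
def bLog (u : X →ᵇ ℝ) : X →ᵇ ℝ := if h : ∃ b : X →ᵇ ℝ, ∀ x, b x = Real.log (u x) then h.choose else 0

lemma bLog_apply {u : X →ᵇ ℝ} {m : ℝ} (hm : 0 < m) (hu : ∀ x, m ≤ u x) (x : X) : bLog u x = Real.log (u x) := by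
  have h : ∃ b : X →ᵇ ℝ, ∀ x, b x = Real.log (u x) := by
    refine ⟨BoundedContinuousFunction.ofNormedAddCommGroup (fun x => Real.log (u x)) ?_ (max |Real.log m| |Real.log ‖u‖|) ?_, fun x => rfl⟩
    · exact u.continuous.log fun x => (hm.trans_le (hu x)).ne'
    · intro x
      have h1 := Real.log_le_log hm (hu x)
      have h2 := Real.log_le_log (hm.trans_le (hu x)) ((le_abs_self _).trans (u.norm_coe_le_norm x))
      rw [Real.norm_eq_abs, abs_le]
      constructor
      · have := neg_abs_le (Real.log m)
        have := le_max_left |Real.log m| |Real.log ‖u‖|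
        linarith
      · have := le_abs_self (Real.log ‖u‖)
        have := le_max_right |Real.log m| |Real.log ‖u‖|
        linarith
  rw [bLog, dif_pos h]
  exact h.choose_spec x

lemma bLog_analytic {u : X →ᵇ ℝ} {m : ℝ} (hm : 0 < m) (hu : ∀ x, m ≤ u x) : AnalyticAt ℝ bLog u := by
  let w : X →ᵇ ℝ := BoundedContinuousFunction.ofNormedAddCommGroup (fun x => (u x)⁻¹)
    (u.continuous.inv₀ fun x => (hm.trans_le (hu x)).ne') m⁻¹ (fun x => by
      rw [Real.norm_of_nonneg (inv_nonneg.2 (hm.le.trans (hu x)))]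
      exact inv_anti₀ hm (hu x))
  have hw : ∀ x, w x = (u x)⁻¹ := fun x => rfl
  have huw : 1 - u * w = 0 := by
    ext x
    have := (hm.trans_le (hu x)).ne'
    simp [hw, this]
  have han : AnalyticAt ℝ (fun v : X →ᵇ ℝ => bLog u - serS (1 - v * w)) u := by
    have hS : AnalyticAt ℝ (serS (X := X)) (1 - u * w) := by
      rw [huw]; exact (serS_ball (X := X)).analyticAt
    have hlin : AnalyticAt ℝ (fun v : X →ᵇ ℝ => 1 - v * w) u := analyticAt_const.fun_sub (analyticAt_id.fun_mul analyticAt_const)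
    exact analyticAt_const.fun_sub (AnalyticAt.fun_comp (g := serS (X := X)) (f := fun v : X →ᵇ ℝ => 1 - v * w) hS hlin)
  refine han.congr ?_
  have c1 : ∀ᶠ v : X →ᵇ ℝ in nhds u, ‖1 - v * w‖ < 1 := by
    have : Continuous (fun v : X →ᵇ ℝ => ‖1 - v * w‖) := by fun_prop
    refine this.continuousAt.eventually_lt continuousAt_const ?_
    rw [huw]; simp
  have c2 : ∀ᶠ v : X →ᵇ ℝ in nhds u, ‖v - u‖ < m / 2 := by
    have : Continuous (fun v : X →ᵇ ℝ => ‖v - u‖) := by fun_prop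
    refine this.continuousAt.eventually_lt continuousAt_const ?_
    simp [hm]
  filter_upwards [c1, c2] with v h1 h2
  have hv : ∀ x, m / 2 ≤ v x := fun x => by
    have := ((v - u).norm_coe_le_norm x).trans_lt h2
    rw [BoundedContinuousFunction.sub_apply, Real.norm_eq_abs, abs_lt] at this
    linarith [hu x]
  ext x
  rw [BoundedContinuousFunction.sub_apply, serS_apply h1, bLog_apply hm hu, bLog_apply (half_pos hm) hv]
  have hux := hm.trans_le (hu x)
  have hvx := (half_pos hm).trans_le (hv x)
  simp only [BoundedContinuousFunction.sub_apply, BoundedContinuousFunction.mul_apply, hw, BoundedContinuousFunction.coe_one, Pi.one_apply, sub_sub_cancel]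
  rw [Real.log_mul hvx.ne' (inv_ne_zero hux.ne'), Real.log_inv]
  ring

lemma exp_eval (u : X →ᵇ ℝ) (x : X) : (NormedSpace.exp u) x = Real.exp (u x) := by
  rw [Real.exp_eq_exp_ℝ]
  have h1 := (NormedSpace.exp_series_hasSum_exp' (𝕂 := ℝ) u).mapL (BoundedContinuousFunction.evalCLM ℝ x)
  have h2 := (NormedSpace.exp_series_hasSum_exp' (𝕂 := ℝ) (u x))
  refine HasSum.unique ?_ h2
  simpa using h1
end logs

section kern
variable {d : ℕ} {K : Set (Euc d)} 

lemma exists_q (hm : ∃ m > 0, ∀ x ∈ K, m ≤ ‖x‖) :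
    ∃ q : Euc d → (K →ᵇ ℝ), (∀ y, AnalyticAt ℝ q y) ∧ ∀ y (x : K), q y x = ‖(x : Euc d) - y‖ ^ 2 / ‖(x : Euc d)‖ ^ 2 := by
  obtain ⟨m, hm, hK⟩ := hm
  have hx0 : ∀ x : K, 0 < ‖(x : Euc d)‖ := fun x => hm.trans_le (hK x x.2)
  let B : K →ᵇ ℝ := BoundedContinuousFunction.ofNormedAddCommGroup (fun x => (‖(x : Euc d)‖ ^ 2)⁻¹)
    (by
      refine Continuous.inv₀ (by fun_prop) fun x => ?_
      have := hx0 x; positivity) (m ^ 2)⁻¹ (fun x => by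
      rw [Real.norm_of_nonneg (by positivity)]
      have := hK x x.2
      gcongr)
  let Li : Fin d → (K →ᵇ ℝ) := fun i => BoundedContinuousFunction.ofNormedAddCommGroup (fun x => (x : Euc d) i / ‖(x : Euc d)‖ ^ 2)
    (by
      refine Continuous.div (by fun_prop) (by fun_prop) fun x => ?_
      have := hx0 x; positivity) m⁻¹ (fun x => by
      have := hK x x.2
      have h0 := hx0 x
      have h1 : ‖(x : Euc d) i‖ ≤ ‖(x : Euc d)‖ := PiLp.norm_apply_le _ i
      rw [norm_div, Real.norm_of_nonneg (by positivity : 0 ≤ ‖(x : Euc d)‖ ^ 2)]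
      calc ‖(x : Euc d) i‖ / ‖(x : Euc d)‖ ^ 2 ≤ ‖(x : Euc d)‖ / ‖(x : Euc d)‖ ^ 2 := by gcongr
        _ = ‖(x : Euc d)‖⁻¹ := by field_simp
        _ ≤ m⁻¹ := by gcongr)
  have hB : ∀ x : K, B x = (‖(x : Euc d)‖ ^ 2)⁻¹ := fun x => rfl
  have hL : ∀ i (x : K), Li i x = (x : Euc d) i / ‖(x : Euc d)‖ ^ 2 := fun i x => rfl
  refine ⟨fun y => 1 - (2:ℝ) • ∑ i, y i • Li i + (∑ i, y i ^ 2) • B, fun y => ?_, fun y x => ?_⟩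
  · have hi : ∀ i : Fin d, AnalyticAt ℝ (fun y : Euc d => y i) y := fun i =>
      (EuclideanSpace.proj (𝕜 := ℝ) i : Euc d →L[ℝ] ℝ).analyticAt y
    refine AnalyticAt.fun_add (analyticAt_const.fun_sub (AnalyticAt.fun_smul analyticAt_const ?_)) (AnalyticAt.fun_smul ?_ analyticAt_const)
    · exact Finset.analyticAt_fun_sum _ fun i _ => (hi i).fun_smul analyticAt_const
    · exact Finset.analyticAt_fun_sum _ fun i _ => (hi i).fun_pow 2
  · have h0 := (hx0 x).ne'
    have e2 : (∑ i, y i • Li i) x = ⟪(x : Euc d), y⟫ / ‖(x : Euc d)‖ ^ 2 := by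
      rw [BoundedContinuousFunction.sum_apply, PiLp.inner_apply, Finset.sum_div]
      refine Finset.sum_congr rfl fun i _ => ?_
      simp [hL]
      ring
    have e3 : ∑ i, y i ^ 2 = ‖y‖ ^ 2 := by rw [EuclideanSpace.real_norm_sq_eq]
    rw [BoundedContinuousFunction.add_apply, BoundedContinuousFunction.sub_apply, BoundedContinuousFunction.smul_apply,
      BoundedContinuousFunction.smul_apply, e2, e3, hB, norm_sub_sq_real]
    simp
    field_simp

lemma q_lower (hKc : IsClosed K) (h0 : (0 : Euc d) ∉ K) {y : Euc d} (hy : y ∉ K) :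
    ∃ m > 0, ∀ x : K, m ≤ ‖(x : Euc d) - y‖ ^ 2 / ‖(x : Euc d)‖ ^ 2 := by
  obtain ⟨r, hr, hrK⟩ := Metric.isOpen_iff.1 hKc.isOpen_compl y hy
  refine ⟨(r / (r + ‖y‖)) ^ 2, by positivity, fun x => ?_⟩
  have h1 : r ≤ ‖(x : Euc d) - y‖ := by
    by_contra! h
    exact hrK (by simpa [dist_eq_norm] using h) x.2
  have hx : 0 < ‖(x : Euc d)‖ := norm_pos_iff.2 fun h => h0 (h ▸ x.2)
  have h2 : ‖(x : Euc d)‖ ≤ ‖(x : Euc d) - y‖ + ‖y‖ := by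
    simpa using norm_add_le ((x : Euc d) - y) y
  rw [← div_pow]
  gcongr ?_ ^ 2
  rw [div_le_div_iff₀ (by positivity) hx]
  nlinarith [norm_nonneg y]

lemma away (hKc : IsClosed K) (h0 : (0 : Euc d) ∉ K) : ∃ m > 0, ∀ x ∈ K, m ≤ ‖x‖ := by
  obtain ⟨r, hr, hrK⟩ := Metric.isOpen_iff.1 hKc.isOpen_compl 0 h0
  refine ⟨r, hr, fun x hx => ?_⟩
  by_contra! h
  exact hrK (by simpa using h) hx

/-- radial profile of the fundamental solution -/
def prf (d : ℕ) (s : ℝ) : ℝ := if d = 2 then -(1 / (4 * Real.pi)) * Real.log s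
  else (1 / (4 * Real.pi)) * Real.exp (-(1/2) * Real.log s)

lemma Phi_eq {x y : Euc d} (h : x ≠ y) : Phi d x y = prf d (‖x - y‖ ^ 2) := by
  have hp : 0 < ‖x - y‖ := norm_pos_iff.2 (sub_ne_zero.2 h)
  have hpi := Real.pi_pos
  unfold Phi prf
  split_ifs
  · rw [Real.log_pow, one_div ‖x - y‖, Real.log_inv]
    push_cast
    field_simp
    norm_num
    ring
  · rw [Real.log_pow]
    push_cast
    rw [show -(1/2) * (2 * Real.log ‖x - y‖) = -Real.log ‖x - y‖ by ring, Real.exp_neg, Real.exp_log hp]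
    simp

lemma prf_prof (hd : d = 2 ∨ d = 3) : ∃ c, Prof d (prf d) c := by
  have hpi := Real.pi_pos
  rcases hd with rfl | rfl
  · refine ⟨1 / (4 * Real.pi), ⟨fun s hs => ?_, fun s hs => ?_, by positivity⟩⟩
    · have := (Real.hasDerivAt_log hs.ne').const_mul (-(1 / (4 * Real.pi)))
      have e : s ^ (-((2:ℕ):ℝ)/2) = s⁻¹ := by
        rw [show -((2:ℕ):ℝ)/2 = -1 by norm_num, Real.rpow_neg_one]
      rw [e]
      exact this
    · have h := Real.contDiffAt_log (n := 2).2 hs.ne'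
      exact contDiffAt_const.mul h
  · refine ⟨1 / (8 * Real.pi), ⟨fun s hs => ?_, fun s hs => ?_, by positivity⟩⟩
    · have := (((Real.hasDerivAt_log hs.ne').const_mul (-(1/2))).exp).const_mul (1 / (4 * Real.pi))
      have e : s ^ (-((3:ℕ):ℝ)/2) = Real.exp (-(1/2) * Real.log s) * s⁻¹ := by
        rw [show -((3:ℕ):ℝ)/2 = -(1/2) + -1 by norm_num, Real.rpow_add hs, Real.rpow_neg_one, Real.rpow_def_of_pos hs]
        ring_nf
      rw [e]
      convert! this using 1
      field_simp
      norm_num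
    · have h := Real.contDiffAt_log (n := 2).2 hs.ne'
      exact contDiffAt_const.mul (contDiffAt_const.mul h).exp

lemma exists_H (hKc : IsClosed K) (h0 : (0 : Euc d) ∉ K) :
    ∃ H : Euc d → (K →ᵇ ℝ), (∀ y, y ∉ K → AnalyticAt ℝ H y) ∧
      ∀ y, y ∉ K → ∀ x : K, H y x = prf d (‖(x : Euc d) - y‖ ^ 2) - prf d (‖(x : Euc d)‖ ^ 2) := by
  have haw := away hKc h0
  obtain ⟨q, hq, hqx⟩ := exists_q haw
  have hlow : ∀ y, y ∉ K → ∃ m > 0, ∀ x, m ≤ q y x := fun y hy => by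
    simpa only [hqx] using q_lower hKc h0 hy
  have hlog : ∀ y, y ∉ K → AnalyticAt ℝ (fun y => bLog (q y)) y := fun y hy => by
    obtain ⟨m, hm, hl⟩ := hlow y hy
    exact (bLog_analytic hm hl).comp (hq y)
  have hx0 : ∀ x : K, 0 < ‖(x : Euc d)‖ := fun x => norm_pos_iff.2 fun h => h0 (h ▸ x.2)
  have hlx : ∀ y, y ∉ K → ∀ x : K, bLog (q y) x = Real.log (‖(x : Euc d) - y‖ ^ 2) - Real.log (‖(x : Euc d)‖ ^ 2) := by
    intro y hy x
    obtain ⟨m, hm, hl⟩ := hlow y hy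
    have hne : 0 < ‖(x : Euc d) - y‖ := norm_pos_iff.2 (sub_ne_zero.2 fun h => hy (h ▸ x.2))
    rw [bLog_apply hm hl, hqx, Real.log_div (by positivity) (by have := hx0 x; positivity)]
  by_cases hd : d = 2
  · refine ⟨fun y => (-(1 / (4 * Real.pi))) • bLog (q y), fun y hy => analyticAt_const.fun_smul (hlog y hy), fun y hy x => ?_⟩
    simp only [prf, hd, if_true]
    rw [BoundedContinuousFunction.smul_apply, hlx y hy, smul_eq_mul]
    ring
  · obtain ⟨m, hm, hK⟩ := haw
    let N : K →ᵇ ℝ := BoundedContinuousFunction.ofNormedAddCommGroup (fun x => (‖(x : Euc d)‖)⁻¹)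
      (Continuous.inv₀ (by fun_prop) fun x => (hx0 x).ne') m⁻¹ (fun x => by
        rw [Real.norm_of_nonneg (by positivity)]
        have := hK x x.2
        gcongr)
    refine ⟨fun y => (1 / (4 * Real.pi)) • (N * (NormedSpace.exp ((-(1/2) : ℝ) • bLog (q y)) - 1)), fun y hy => ?_, fun y hy x => ?_⟩
    · refine analyticAt_const.fun_smul (analyticAt_const.fun_mul (AnalyticAt.fun_sub ?_ analyticAt_const))
      exact AnalyticAt.fun_comp (NormedSpace.exp_analytic (𝕂 := ℝ) _) (analyticAt_const.fun_smul (hlog y hy))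
    · simp only [prf, hd, if_false]
      rw [BoundedContinuousFunction.smul_apply, BoundedContinuousFunction.mul_apply, BoundedContinuousFunction.sub_apply,
        exp_eval, BoundedContinuousFunction.smul_apply, hlx y hy]
      have hN : N x = Real.exp (-(1/2) * Real.log (‖(x : Euc d)‖ ^ 2)) := by
        show (‖(x : Euc d)‖)⁻¹ = _
        rw [Real.log_pow]
        push_cast
        rw [show -(1/2) * (2 * Real.log ‖(x : Euc d)‖) = -Real.log ‖(x : Euc d)‖ by ring, Real.exp_neg, Real.exp_log (hx0 x)]
      rw [hN, mul_sub, smul_eq_mul, smul_eq_mul, ← Real.exp_add]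
      simp only [BoundedContinuousFunction.coe_one, Pi.one_apply, mul_one, mul_sub]
      ring_nf
end kern


section dens
variable {d : ℕ} {K : Set (Euc d)} 

lemma L2_sub_const (f : Euc d → ℝ) (c : ℝ) (y : Euc d) : L2 (fun z => f z - c) y = L2 f y := by
  have : fderiv ℝ (fun z => f z - c) = fderiv ℝ f := by
    ext1 z
    exact fderiv_sub_const c
  unfold L2
  rw [this]

lemma H_L2 (hd : d = 2 ∨ d = 3) (hKc : IsClosed K) {H : Euc d → (K →ᵇ ℝ)} (hHa : ∀ y, y ∉ K → AnalyticAt ℝ H y)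
    (hHx : ∀ y, y ∉ K → ∀ x : K, H y x = prf d (‖(x : Euc d) - y‖ ^ 2) - prf d (‖(x : Euc d)‖ ^ 2))
    {y : Euc d} (hy : y ∉ K) : L2 H y = 0 := by
  obtain ⟨c, hc⟩ := prf_prof hd
  ext x
  have h1 := L2_comp (BoundedContinuousFunction.evalCLM ℝ x) ((hHa y hy).contDiffAt (n := 2))
  simp only [BoundedContinuousFunction.evalCLM_apply] at h1
  rw [← h1]
  have h2 : (fun z => H z x) =ᶠ[nhds y] fun z => prf d (‖(x : Euc d) - z‖ ^ 2 + 0) - prf d (‖(x : Euc d)‖ ^ 2) := by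
    filter_upwards [hKc.isOpen_compl.mem_nhds hy] with z hz
    rw [hHx z hz, add_zero]
  rw [L2_congr h2, L2_sub_const (fun z => prf d (‖(x : Euc d) - z‖ ^ 2 + 0))]
  have hne : 0 < ‖(x : Euc d) - y‖ := norm_pos_iff.2 (sub_ne_zero.2 fun h => hy (h ▸ x.2))
  rw [prof_L2 hc _ _ _ (by positivity)]
  simp

lemma H_normal {δ : ℝ} (hKc : IsClosed K) {H : Euc d → (K →ᵇ ℝ)} (hHa : ∀ y, y ∉ K → AnalyticAt ℝ H y)
    (hHx : ∀ y, y ∉ K → ∀ x : K, H y x = prf d (‖(x : Euc d) - y‖ ^ 2) - prf d (‖(x : Euc d)‖ ^ 2))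
    {y : Euc d} (hy : y ∉ K) (x : K) : normalDerivY d 0 δ x y = (fderiv ℝ H y (δ⁻¹ • y)) x := by
  unfold normalDerivY
  rw [sub_zero]
  have h1 : HasDerivAt (fun s : ℝ => H (y + s • (δ⁻¹ • y))) (fderiv ℝ H (y + (0:ℝ) • (δ⁻¹ • y)) (δ⁻¹ • y)) 0 :=
    hasDerivAt_line (by simpa using (hHa y hy).differentiableAt)
  have h2 := ((BoundedContinuousFunction.evalCLM ℝ x).hasFDerivAt.comp_hasDerivAt (0:ℝ) h1).add_const (prf d (‖(x : Euc d)‖ ^ 2))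
  rw [zero_smul, add_zero] at h2
  refine (h2.congr_of_eventuallyEq ?_).deriv
  have hc : Tendsto (fun t : ℝ => y + t • (δ⁻¹ • y)) (nhds 0) (nhds y) := by
    have : Continuous (fun t : ℝ => y + t • (δ⁻¹ • y)) := by fun_prop
    simpa using this.tendsto 0
  filter_upwards [hc.eventually (hKc.isOpen_compl.mem_nhds hy)] with t ht
  have hne : (x : Euc d) ≠ y + t • (δ⁻¹ • y) := fun h => ht (by rw [← h]; exact x.2)
  rw [Phi_eq hne]
  simp only [Function.comp, BoundedContinuousFunction.evalCLM_apply]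
  rw [hHx _ ht]
  ring

lemma sm_integrable (hd : 0 < d) {δ : ℝ} (hδ : 0 < δ) {E : Type*} [NormedAddCommGroup E] {v : Euc d → E} (hv : ContinuousOn v (sphere 0 δ)) :
    Integrable v (sphereMeasure (0 : Euc d) δ) := by
  have := sm_finite hd hδ
  have h := hv.integrableOn_compact (μ := sphereMeasure (0 : Euc d) δ) (isCompact_sphere _ _)
  unfold sphereMeasure at h ⊢
  rwa [IntegrableOn, Measure.restrict_restrict isClosed_sphere.measurableSet, Set.inter_self] at h

lemma hb_sub {E : Type*} [NormedAddCommGroup E] [NormedSpace ℝ E] (M : Submodule ℝ E) {x : E}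
    (h : ∀ l : E →L[ℝ] ℝ, (∀ m ∈ M, l m = 0) → l x = 0) : x ∈ closure (M : Set E) := by
  by_contra hx
  rw [← Submodule.topologicalClosure_coe] at hx
  obtain ⟨l, u, h1, h2⟩ := geometric_hahn_banach_closed_point M.topologicalClosure.convex
    M.isClosed_topologicalClosure hx
  have hu : 0 < u := by simpa using h1 0 (zero_mem _)
  have hz : ∀ m ∈ M, l m = 0 := by
    intro m hm
    by_contra hne
    have h3 := h1 ((u / l m) • m) (M.le_topologicalClosure (M.smul_mem _ hm))
    rw [map_smul, smul_eq_mul, div_mul_cancel₀ _ hne] at h3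
    exact lt_irrefl _ h3
  have := h l hz
  linarith

lemma density (hd : d = 2 ∨ d = 3) {δ ε : ℝ} (hδ : 0 < δ) (hε : 0 < ε) (hKc : IsClosed K) (hKδ : ∀ y ∈ closedBall (0 : Euc d) δ, y ∉ K)
    {f : Euc d → ℝ} (hf : ContDiff ℝ 2 f) (hs : HasCompactSupport f) (hfK : ∀ x ∈ K, L2 f =ᶠ[nhds x] 0)
    {W : Set (Euc d)} (hWK : ∀ y ∈ W, y ∉ K) (hW : IsPreconnected W) (hW0 : (0 : Euc d) ∈ W)
    (hfW : ∀ y, y ∉ W → L2 f y = 0) :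
    ∃ g : Euc d → ℝ, ContinuousOn g (sphere (0 : Euc d) δ) ∧ ∀ x ∈ K, |Dpot δ g x - f x| ≤ ε := by
  have hd0 : 0 < d := by omega
  have h0K : (0 : Euc d) ∉ K := hKδ 0 (by simp [hδ.le])
  have hSK : ∀ y ∈ sphere (0 : Euc d) δ, y ∉ K := fun y hy => hKδ y (sphere_subset_closedBall hy)
  obtain ⟨H, hHa, hHx⟩ := exists_H hKc h0K
  obtain ⟨c, hc⟩ := prf_prof hd
  set κ : Euc d → (K →ᵇ ℝ) := fun y => fderiv ℝ H y (δ⁻¹ • y) with hκ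
  have hκc : ContinuousOn κ (sphere 0 δ) := fun y hy => by
    have h1 : ContinuousAt (fderiv ℝ H) y := (hHa y (hSK y hy)).fderiv.continuousAt
    have h2 : ContinuousAt (fun y : Euc d => δ⁻¹ • y) y := by fun_prop
    exact (h1.clm_apply h2).continuousWithinAt
  have hgi : ∀ g : Euc d → ℝ, ContinuousOn g (sphere 0 δ) → Integrable (fun y => g y • κ y) (sphereMeasure (0 : Euc d) δ) :=
    fun g hg => sm_integrable hd0 hδ (hg.smul hκc)
  let M : Submodule ℝ (K →ᵇ ℝ) :=
    { carrier := {e | ∃ g : Euc d → ℝ, ContinuousOn g (sphere 0 δ) ∧ e = ∫ y, g y • κ y ∂(sphereMeasure (0 : Euc d) δ)}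
      add_mem' := by
        rintro _ _ ⟨g, hg, rfl⟩ ⟨g', hg', rfl⟩
        refine ⟨fun y => g y + g' y, hg.add hg', ?_⟩
        rw [← integral_add (hgi g hg) (hgi g' hg')]
        simp only [add_smul]
      zero_mem' := ⟨fun _ => 0, continuousOn_const, by simp⟩
      smul_mem' := by
        rintro c _ ⟨g, hg, rfl⟩
        refine ⟨fun y => c * g y, continuousOn_const.mul hg, ?_⟩
        rw [← integral_smul]
        simp only [mul_smul] }
  obtain ⟨C, hC⟩ := hs.exists_bound_of_continuous hf.continuous
  let F : K →ᵇ ℝ := BoundedContinuousFunction.ofNormedAddCommGroup (fun x => f x) (hf.continuous.comp continuous_subtype_val) C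
    (fun x => hC x)
  have hcl : F ∈ closure (M : Set (K →ᵇ ℝ)) := by
    refine hb_sub M fun l hl => ?_
    set h : Euc d → ℝ := fun y => l (H y) with hh
    have hha : ∀ y, y ∉ K → AnalyticAt ℝ h y := fun y hy => (l.analyticAt _).fun_comp (hHa y hy)
    have hfd : ∀ y, y ∉ K → ∀ e, fderiv ℝ h y e = l (fderiv ℝ H y e) := fun y hy e => by
      have := (l.hasFDerivAt.comp y (hHa y hy).differentiableAt.hasFDerivAt).fderiv
      show fderiv ℝ (⇑l ∘ H) y e = _
      rw [this]; rfl
    have hv0 : ∀ y ∈ sphere (0 : Euc d) δ, l (κ y) = 0 := by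
      have hvc : ContinuousOn (fun y => l (κ y)) (sphere (0 : Euc d) δ) := l.continuous.comp_continuousOn hκc
      refine sm_zero hd0 hδ hvc ?_
      have h1 := hl _ ⟨fun y => l (κ y), hvc, rfl⟩
      rw [← l.integral_comp_comm (hgi _ hvc)] at h1
      simpa using h1
    have hn : ∀ x ∈ closedBall (0 : Euc d) δ, h x = h 0 := by
      refine neumann hd0 hδ hKc.isOpen_compl (fun y hy => hKδ y hy)
        (fun y hy => ((hha y hy).contDiffAt).contDiffWithinAt) (fun y hy => ?_) (fun y hy => ?_)
      · rw [hh, L2_comp l ((hHa y hy).contDiffAt), H_L2 hd hKc hHa hHx hy, map_zero]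
      · have h1 := hv0 y hy
        rw [hfd y (hSK y hy)]
        simp only [hκ, map_smul, smul_eq_mul] at h1
        exact (mul_eq_zero.1 h1).resolve_left (inv_ne_zero hδ.ne')
    have hH0 : H 0 = 0 := by
      ext x
      rw [hHx 0 h0K]
      simp
    have h00 : h 0 = 0 := by rw [hh]; simp [hH0]
    have hW' : Set.EqOn h 0 W := by
      refine AnalyticOnNhd.eqOn_zero_of_preconnected_of_eventuallyEq_zero (fun y hy => hha y (hWK y hy)) hW hW0 ?_
      filter_upwards [closedBall_mem_nhds (0 : Euc d) hδ] with y hy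
      rw [hn y hy, h00]; rfl
    have hcont : Continuous (fun y => L2 f y • H y) := by
      rw [continuous_iff_continuousAt]
      intro y
      by_cases hy : y ∈ K
      · refine (continuousAt_const (y := (0 : K →ᵇ ℝ))).congr ?_
        filter_upwards [hfK y hy] with z hz
        rw [hz]; simp
      · exact (L2_continuous hf).continuousAt.smul (hHa y hy).continuousAt
    have hint : Integrable (fun y => L2 f y • H y) :=
      hcont.integrable_of_hasCompactSupport ((L2_compact hs).smul_right)
    have hT : ∫ y, L2 f y • H y = (-2 * c * d * newtI d) • F := by
      ext x
      have h1 := (BoundedContinuousFunction.evalCLM ℝ x).integral_comp_comm hint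
      rw [BoundedContinuousFunction.evalCLM_apply] at h1
      rw [← h1, BoundedContinuousFunction.smul_apply]
      show _ = (-2 * c * d * newtI d) * f x
      rw [← newton hc hf hs x (hfK x x.2)]
      have hLi : Integrable (L2 f) := (L2_continuous hf).integrable_of_hasCompactSupport (L2_compact hs)
      have e1 : ∀ y, (BoundedContinuousFunction.evalCLM ℝ x) (L2 f y • H y) + L2 f y * prf d (‖(x : Euc d)‖ ^ 2) = 
          prf d (‖(x : Euc d) - y‖ ^ 2) * L2 f y := by
        intro y
        rw [BoundedContinuousFunction.evalCLM_apply, BoundedContinuousFunction.smul_apply, smul_eq_mul]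
        by_cases hy : y ∈ K
        · rw [(hfK y hy).self_of_nhds]; simp
        · rw [hHx y hy]; ring
      have h2 : Integrable (fun y => (BoundedContinuousFunction.evalCLM ℝ x) (L2 f y • H y)) :=
        (BoundedContinuousFunction.evalCLM ℝ x).integrable_comp hint
      simp_rw [← e1]
      rw [integral_add h2 (hLi.mul_const _), integral_mul_const, int_L2_zero hf hs, zero_mul, add_zero]
    have h5 : l (∫ y, L2 f y • H y) = 0 := by
      rw [← l.integral_comp_comm hint]
      refine integral_eq_zero_of_ae (Eventually.of_forall fun y => ?_)
      simp only [map_smul, smul_eq_mul, Pi.zero_apply]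
      by_cases hy : y ∈ W
      · have : h y = 0 := hW' hy
        rw [show l (H y) = 0 from this, mul_zero]
      · rw [hfW y hy, zero_mul]
    rw [hT, map_smul, smul_eq_mul] at h5
    refine (mul_eq_zero.1 h5).resolve_left ?_
    have := newtI_pos d
    have := hc.hc
    have : (d : ℝ) ≠ 0 := by exact_mod_cast hd0.ne'
    refine mul_ne_zero (mul_ne_zero (mul_ne_zero (by norm_num) hc.hc) this) (newtI_pos d).ne'
  obtain ⟨m, ⟨g, hg, hm⟩, hmF⟩ := Metric.mem_closure_iff.1 hcl ε hε
  refine ⟨g, hg, fun x hx => ?_⟩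
  have hD : Dpot δ g x = m ⟨x, hx⟩ := by
    have h1 := (BoundedContinuousFunction.evalCLM ℝ (⟨x, hx⟩ : K)).integral_comp_comm (hgi g hg)
    rw [BoundedContinuousFunction.evalCLM_apply] at h1
    rw [hm, ← h1]
    unfold Dpot
    unfold sphereMeasure
    refine setIntegral_congr_fun isClosed_sphere.measurableSet fun y hy => ?_
    simp only [BoundedContinuousFunction.evalCLM_apply, BoundedContinuousFunction.smul_apply, smul_eq_mul]
    rw [← H_normal hKc hHa hHx (hSK y hy)]
  have h2 := ((m - F).norm_coe_le_norm ⟨x, hx⟩)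
  rw [dist_comm, dist_eq_norm] at hmF
  rw [hD]
  exact h2.trans hmF.le
end dens


section geom
variable {d : ℕ}

lemma preconn_W (hd : d = 2 ∨ d = 3) {a a' : ℝ} {x₀ : Euc d} (ha : 0 < a) (haa : a < a') (hx : a' < ‖x₀‖) :
    IsPreconnected (ball (0 : Euc d) (‖x₀‖ - a) ∪ {y | a < dist y x₀ ∧ dist y x₀ < a'}) := by
  have hn : 0 < ‖x₀‖ := by linarith
  have hrank : 1 < Module.rank ℝ (Euc d) := by
    rw [← Module.finrank_eq_rank, finrank_euclideanSpace_fin]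
    have : 1 < d := by omega
    exact_mod_cast this
  have hA : {y : Euc d | a < dist y x₀ ∧ dist y x₀ < a'} =
      (fun p : Euc d × ℝ => x₀ + p.2 • p.1) '' (sphere (0 : Euc d) 1 ×ˢ Set.Ioo a a') := by
    ext y
    constructor
    · rintro ⟨h1, h2⟩
      have hp : 0 < dist y x₀ := ha.trans h1
      refine ⟨((dist y x₀)⁻¹ • (y - x₀), dist y x₀), ⟨?_, h1, h2⟩, ?_⟩
      · rw [mem_sphere_zero_iff_norm, norm_smul, norm_inv, Real.norm_of_nonneg hp.le, ← dist_eq_norm]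
        exact inv_mul_cancel₀ hp.ne'
      · simp only
        rw [smul_inv_smul₀ hp.ne']
        abel
    · rintro ⟨⟨u, r⟩, ⟨h1, h2, h3⟩, rfl⟩
      simp only at h2 h3
      have hu : ‖u‖ = 1 := by simpa using h1
      have : dist (x₀ + r • u) x₀ = r := by
        rw [dist_eq_norm, add_sub_cancel_left, norm_smul, hu, mul_one, Real.norm_of_nonneg (ha.trans h2).le]
      simp only [Set.mem_ofPred_eq, this]
      exact ⟨h2, h3⟩
  set t := (a + a') / 2 / ‖x₀‖ with ht
  have htn : t * ‖x₀‖ = (a + a') / 2 := by rw [ht]; field_simp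
  have ht0 : 0 < t := div_pos (by linarith) hn
  have ht1 : t < 1 := by rw [ht, div_lt_one hn]; linarith
  refine IsPreconnected.union (x₀ - t • x₀) ?_ ?_ (convex_ball _ _).isPreconnected ?_
  · rw [mem_ball_zero_iff, show x₀ - t • x₀ = (1 - t) • x₀ by rw [sub_smul, one_smul], norm_smul,
      Real.norm_of_nonneg (by linarith), sub_mul, htn]
    linarith
  · have : dist (x₀ - t • x₀) x₀ = (a + a') / 2 := by
      rw [dist_eq_norm, sub_sub_cancel_left, norm_neg, norm_smul, Real.norm_of_nonneg ht0.le, htn]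
    simp only [Set.mem_ofPred_eq, this]
    constructor <;> linarith
  · rw [hA]
    refine ((isPreconnected_sphere hrank 0 1).prod isPreconnected_Ioo).image _ ?_
    exact Continuous.continuousOn (by fun_prop)

lemma L2_sub {u v : Euc d → ℝ} {x : Euc d} (hu : ContDiffAt ℝ 2 u x) (hv : ContDiffAt ℝ 2 v x) :
    L2 (fun y => u y - v y) x = L2 u x - L2 v x := by
  have hP : ContDiffAt ℝ 2 (fun y => (u y, v y)) x := hu.prodMk hv
  have h1 := L2_comp (ContinuousLinearMap.fst ℝ ℝ ℝ) hP
  have h2 := L2_comp (ContinuousLinearMap.snd ℝ ℝ ℝ) hP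
  have h3 := L2_comp (ContinuousLinearMap.fst ℝ ℝ ℝ - ContinuousLinearMap.snd ℝ ℝ ℝ) hP
  rw [sub_apply, ← h1, ← h2] at h3
  exact h3

lemma exists_f {a a' : ℝ} {x₀ : Euc d} (ha : 0 < a) (haa : a < a') {u₀ u₁ : Euc d → ℝ}
    (hu₀ : IsHarmonicOn u₀ (ball x₀ a')) (hu₁ : IsHarmonicOn u₁ (ball x₀ a')) :
    ∃ f : Euc d → ℝ, ContDiff ℝ 2 f ∧ HasCompactSupport f ∧ (∀ x ∈ closedBall x₀ a, f x = u₁ x - u₀ x) ∧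
      (∀ x, a' ≤ dist x x₀ → f x = 0) ∧ (∀ x, dist x x₀ ≤ a ∨ a' ≤ dist x x₀ → L2 f =ᶠ[nhds x] 0) := by
  let χ : ContDiffBump x₀ := ⟨(2 * a + a') / 3, (a + 2 * a') / 3, by linarith, by linarith⟩
  have hi : χ.rIn = (2 * a + a') / 3 := rfl
  have ho : χ.rOut = (a + 2 * a') / 3 := rfl
  have hcd : ∀ {u : Euc d → ℝ}, IsHarmonicOn u (ball x₀ a') → ∀ x ∈ ball x₀ a', ContDiffAt ℝ 2 u x :=
    fun hu x hx => hu.1.contDiffAt (isOpen_ball.mem_nhds hx)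
  have hl : ∀ {u : Euc d → ℝ}, IsHarmonicOn u (ball x₀ a') → ∀ x ∈ ball x₀ a', L2 u x = 0 :=
    fun hu x hx => by rw [← lap_eq_L2 (hcd hu x hx), hu.2 x hx]
  set f : Euc d → ℝ := fun x => χ x * (u₁ x - u₀ x) with hfdef
  have hout : ∀ x, χ.rOut < dist x x₀ → f =ᶠ[nhds x] fun _ => 0 := fun x hx => by
    have : ∀ᶠ y in nhds x, χ.rOut < dist y x₀ :=
      continuousAt_const.eventually_lt (continuous_id.dist continuous_const).continuousAt hx
    filter_upwards [this] with y hy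
    rw [hfdef]
    simp only
    rw [χ.zero_of_le_dist hy.le, zero_mul]
  have hin : ∀ x, dist x x₀ < χ.rIn → f =ᶠ[nhds x] fun y => u₁ y - u₀ y := fun x hx => by
    filter_upwards [isOpen_ball.mem_nhds (mem_ball.2 hx)] with y hy
    rw [hfdef]
    simp only
    rw [χ.one_of_mem_closedBall (ball_subset_closedBall hy), one_mul]
  refine ⟨f, ?_, ?_, ?_, ?_, ?_⟩
  · rw [contDiff_iff_contDiffAt]
    intro x
    by_cases hx : x ∈ ball x₀ a'
    · exact χ.contDiffAt.mul ((hcd hu₁ x hx).sub (hcd hu₀ x hx))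
    · refine contDiffAt_const.congr_of_eventuallyEq (hout x ?_)
      rw [mem_ball, not_lt] at hx
      rw [ho]; linarith
  · exact χ.hasCompactSupport.mul_right
  · intro x hx
    rw [mem_closedBall] at hx
    exact (hin x (by rw [hi]; linarith)).self_of_nhds
  · intro x hx
    exact (hout x (by rw [ho]; linarith)).self_of_nhds
  · rintro x (hx | hx)
    · have : ∀ᶠ y in nhds x, dist y x₀ < χ.rIn := isOpen_ball.mem_nhds (mem_ball.2 (by rw [hi]; linarith))
      filter_upwards [this] with y hy
      have hy' : y ∈ ball x₀ a' := by rw [mem_ball]; rw [hi] at hy; linarith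
      rw [L2_congr (hin y hy), L2_sub (hcd hu₁ y hy') (hcd hu₀ y hy'), hl hu₁ y hy', hl hu₀ y hy']
      simp
    · have : ∀ᶠ y in nhds x, χ.rOut < dist y x₀ :=
        continuousAt_const.eventually_lt (continuous_id.dist continuous_const).continuousAt (by rw [ho]; linarith)
      filter_upwards [this] with y hy
      rw [L2_congr (hout y hy)]
      simp [L2]
end geom

/-- for every accuracy `ε > 0` there are infinitely many continuous
densities `g` on `∂B_δ(0)` whose double-layer potentials `u = Dg` satisfy
`‖u + u₀ - u₁‖_{C(closure(B_a(x₀)))} ≤ ε` and `‖u‖_{C(ℝᵈ ∖ B_R(0))} ≤ ε`. -/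
theorem stmt18 {d : ℕ} (hd : d = 2 ∨ d = 3) (δ a a' R' R ε : ℝ) (x₀ : Euc d)
    (hδ : 0 < δ) (ha : 0 < a) (haa : a < a') (hRR : R' < R)
    (hx₀ : a' + δ < ‖x₀‖) (hR' : ‖x₀‖ + a' < R') (hε : 0 < ε)
    (u₀ u₁ : Euc d → ℝ)
    (hu₀h : IsHarmonicOn u₀ {x : Euc d | R < ‖x‖})
    (hu₀c : ContinuousOn u₀ {x : Euc d | R ≤ ‖x‖})
    (hu₀b : d = 2 → ∃ C : ℝ, ∀ x : Euc d, R ≤ ‖x‖ → |u₀ x| ≤ C)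
    (hu₀inf : d = 3 → Tendsto u₀ (Bornology.cobounded (Euc d)) (nhds 0))
    (hu₀a : IsHarmonicOn u₀ (ball x₀ a')) (hu₀ac : ContinuousOn u₀ (closedBall x₀ a'))
    (hu₁ : IsHarmonicOn u₁ (ball x₀ a')) (hu₁c : ContinuousOn u₁ (closedBall x₀ a')) :
    {g : Euc d → ℝ | ContinuousOn g (sphere (0 : Euc d) δ) ∧
      (∀ x ∈ closedBall x₀ a, |Dpot δ g x + u₀ x - u₁ x| ≤ ε) ∧
      (∀ x : Euc d, R ≤ ‖x‖ → |Dpot δ g x| ≤ ε)}.Infinite := by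
  classical
  obtain ⟨f, hf, hs, hfa, hfo, hfL⟩ := exists_f ha haa hu₀a hu₁
  have hfar : ∀ x : Euc d, R ≤ ‖x‖ → a' ≤ dist x x₀ := fun x hx => by
    have : ‖x‖ ≤ dist x x₀ + ‖x₀‖ := by
      rw [dist_eq_norm]; simpa using norm_add_le (x - x₀) x₀
    linarith
  have htri : ∀ y : Euc d, ‖x₀‖ ≤ ‖y‖ + dist y x₀ := fun y => by
    rw [dist_eq_norm, norm_sub_rev]; simpa using norm_add_le y (x₀ - y)
  have htri2 : ∀ y : Euc d, ‖y‖ ≤ dist y x₀ + ‖x₀‖ := fun y => by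
    rw [dist_eq_norm]; simpa using norm_add_le (y - x₀) x₀
  obtain ⟨g, hg, hgK⟩ := density (K := closedBall x₀ a ∪ {x : Euc d | R ≤ ‖x‖}) hd hδ hε
    (isClosed_closedBall.union (isClosed_le continuous_const continuous_norm))
    (by
      intro y hy hyK
      rw [mem_closedBall_zero_iff] at hy
      have := htri y
      rcases hyK with h | h
      · rw [mem_closedBall] at h
        linarith
      · have h' : R ≤ ‖y‖ := h
        linarith [norm_nonneg x₀])
    hf hs
    (by
      rintro x (hx | hx)
      · exact hfL x (Or.inl hx)
      · exact hfL x (Or.inr (hfar x hx)))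
    (W := ball (0 : Euc d) (‖x₀‖ - a) ∪ {y | a < dist y x₀ ∧ dist y x₀ < a'})
    (by
      intro y hy hyK
      have h1 := htri y
      have h2 := htri2 y
      rcases hyK with h | h
      · rw [mem_closedBall] at h
        rcases hy with hy | hy
        · rw [mem_ball_zero_iff] at hy; linarith
        · exact absurd hy.1 (not_lt.2 h)
      · have h' : R ≤ ‖y‖ := h
        rcases hy with hy | hy
        · rw [mem_ball_zero_iff] at hy; linarith
        · linarith [hy.2])
    (preconn_W hd ha haa (by linarith))
    (Or.inl (by rw [mem_ball_zero_iff, norm_zero]; linarith))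
    (by
      intro y hy
      refine (hfL y ?_).self_of_nhds
      by_contra! h
      exact hy (Or.inr h))
  have h0 : (0 : Euc d) ∉ sphere (0 : Euc d) δ := by simp [hδ.ne]
  set G : ℕ → Euc d → ℝ := fun n y => if y ∈ sphere (0 : Euc d) δ then g y else n with hG
  have hGg : ∀ n, Set.EqOn (G n) g (sphere 0 δ) := fun n y hy => by
    simp only [hG]
    rw [if_pos hy]
  have hDG : ∀ n x, Dpot δ (G n) x = Dpot δ g x := fun n x => by
    unfold Dpot sphereMeasure
    refine setIntegral_congr_fun isClosed_sphere.measurableSet fun y hy => ?_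
    simp only [hGg n hy]
  refine Set.infinite_of_injective_forall_mem (f := G) ?_ ?_
  · intro n m hnm
    have := congrFun hnm 0
    simp only [hG] at this
    rw [if_neg h0, if_neg h0] at this
    exact_mod_cast this
  · intro n
    refine ⟨hg.congr (hGg n), fun x hx => ?_, fun x hx => ?_⟩
    · have := hgK x (Or.inl hx)
      rw [hDG, show Dpot δ g x + u₀ x - u₁ x = Dpot δ g x - (u₁ x - u₀ x) by ring, ← hfa x hx]
      exact this
    · have := hgK x (Or.inr hx)
      rw [hfo x (hfar x hx), sub_zero] at this
      rw [hDG]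
      exact this
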